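/- Fix a constant t ∈ (0, 1/2). For each N, let P_N be a random N×N matrix whose entries are i.i.d. {0,1}-valued random variables with P(entry = 1) = t. Then there exists a sequence ε_N → 0 such that for all N, the probability that P_N is singular (not invertible over ℝ) is at most 2N(1−t)^N + (1 + ε_N) N(N−1) (t² + (1−t)²)^N. In particular, the probability that P_N is invertible converges to 1 as N → ∞, exponentially fast. -/

import Mathlib

open Matrix Finset Filter

namespace BernoulliMatrix

section

/-! ### Concentration of random subset sums -/

open scoped Classical in
/-- Point probability at `s` of `∑ i ∈ S, ξ i • u i` for independent Bernoulli(`t`) variables `ξ`,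
written as a sum over the random set `{i ∈ S | ξ i = 1}`. -/
noncomputable def conc {ι G : Type*} [AddCommGroup G] (t : ℝ) (S : Finset ι) (u : ι → G)
    (s : G) : ℝ :=
  ∑ T ∈ S.powerset, (t ^ #T * (1 - t) ^ (#S - #T)) * if ∑ i ∈ T, u i = s then 1 else 0

section Conc

variable {ι G : Type*} [AddCommGroup G] {t : ℝ}

lemma sum_powerset_weight (t : ℝ) (S : Finset ι) :
    ∑ T ∈ S.powerset, (t ^ #T * (1 - t) ^ (#S - #T)) = 1 := by
  rw [Finset.sum_pow_mul_eq_add_pow]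
  simp

lemma conc_nonneg (h0 : 0 ≤ t) (h1 : t ≤ 1) (S : Finset ι) (u : ι → G) (s : G) :
    0 ≤ conc t S u s := by
  unfold conc
  refine sum_nonneg fun T _ => mul_nonneg (mul_nonneg (pow_nonneg h0 _)
    (pow_nonneg (by linarith) _)) ?_
  split_ifs <;> simp

lemma sum_conc_le_one (h0 : 0 ≤ t) (h1 : t ≤ 1) (S : Finset ι) (u : ι → G) (V : Finset G) :
    ∑ s ∈ V, conc t S u s ≤ 1 := by
  classical
  unfold conc
  rw [sum_comm]
  refine le_trans (sum_le_sum fun T _ => ?_) (sum_powerset_weight t S).le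
  rw [← mul_sum]
  refine mul_le_of_le_one_right (mul_nonneg (pow_nonneg h0 _) (pow_nonneg (by linarith) _)) ?_
  rw [sum_ite_eq]
  split_ifs <;> simp

lemma conc_le_one (h0 : 0 ≤ t) (h1 : t ≤ 1) (S : Finset ι) (u : ι → G) (s : G) :
    conc t S u s ≤ 1 := by
  simpa using sum_conc_le_one h0 h1 S u {s}

lemma conc_union [DecidableEq ι] {S U : Finset ι} (hd : Disjoint S U) (u : ι → G) (s : G) :
    conc t (S ∪ U) u s =
      ∑ T ∈ U.powerset, (t ^ #T * (1 - t) ^ (#U - #T)) * conc t S u (s - ∑ i ∈ T, u i) := by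
  classical
  unfold conc
  simp_rw [mul_sum]
  rw [← sum_product']
  symm
  refine sum_bij' (fun P _ => P.2 ∪ P.1) (fun T _ => (T ∩ U, T ∩ S)) ?_ ?_ ?_ ?_ ?_
  · rintro ⟨T, R⟩ h
    simp only [mem_product, mem_powerset] at h ⊢
    exact union_subset_union h.2 h.1
  · intro T _
    simp only [mem_product, mem_powerset]
    exact ⟨inter_subset_right, inter_subset_right⟩
  · rintro ⟨T, R⟩ h
    simp only [mem_product, mem_powerset] at h
    have e1 : (R ∪ T) ∩ U = T := by
      ext x
      have := @h.1 x
      have := @h.2 x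
      have := fun hx : x ∈ S => Finset.disjoint_left.1 hd hx
      simp only [mem_inter, mem_union]; tauto
    have e2 : (R ∪ T) ∩ S = R := by
      ext x
      have := @h.1 x
      have := @h.2 x
      have := fun hx : x ∈ S => Finset.disjoint_left.1 hd hx
      simp only [mem_inter, mem_union]; tauto
    simp [e1, e2]
  · intro T h
    rw [mem_powerset] at h
    change T ∩ S ∪ T ∩ U = T
    rw [← inter_union_distrib_left, inter_eq_left.2 h]
  · rintro ⟨T, R⟩ h
    simp only [mem_product, mem_powerset] at h
    have hRT : Disjoint R T := hd.mono h.2 h.1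
    have e3 : #(S ∪ U) - #(R ∪ T) = (#S - #R) + (#U - #T) := by
      rw [card_union_of_disjoint hd, card_union_of_disjoint hRT]
      have := card_le_card h.1
      have := card_le_card h.2
      omega
    rw [e3, card_union_of_disjoint hRT, sum_union hRT]
    have e5 : (∑ i ∈ R, u i = s - ∑ i ∈ T, u i) ↔ (∑ i ∈ R, u i + ∑ i ∈ T, u i = s) :=
      eq_sub_iff_add_eq
    simp only [e5, pow_add]
    ring

lemma conc_insert [DecidableEq ι] {S : Finset ι} {a : ι} (ha : a ∉ S) (u : ι → G) (s : G) :
    conc t (insert a S) u s = (1 - t) * conc t S u s + t * conc t S u (s - u a) := by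
  have h := conc_union (t := t) (S := S) (U := {a}) (by simpa using ha) u s
  have e : S ∪ {a} = insert a S := by ext; simp
  have e2 : ({a} : Finset ι).powerset = {∅, {a}} := by
    ext T; simp [subset_singleton_iff]
  rw [e, e2, sum_pair (by simp)] at h
  simpa using h

lemma conc_mono_bound (h0 : 0 ≤ t) (h1 : t ≤ 1) {S S' : Finset ι} (hS : S ⊆ S') {u : ι → G}
    {β : ℝ} (hβ : ∀ s, conc t S u s ≤ β) (s : G) : conc t S' u s ≤ β := by
  classical
  have e : S ∪ (S' \ S) = S' := union_sdiff_of_subset hS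
  rw [← e, conc_union disjoint_sdiff]
  calc _ ≤ ∑ T ∈ (S' \ S).powerset, (t ^ #T * (1 - t) ^ (#(S' \ S) - #T)) * β :=
        sum_le_sum fun T _ => mul_le_mul_of_nonneg_left (hβ _)
          (mul_nonneg (pow_nonneg h0 _) (pow_nonneg (by linarith) _))
    _ = β := by rw [← sum_mul, sum_powerset_weight, one_mul]

/-- If every `k` good steps have at least `N` distinct subset sums, the concentration function
decays geometrically to `1 / N` with the number of good steps. -/
lemma conc_le_of_subsetSums [DecidableEq ι] [DecidableEq G] (h0 : 0 < t) (h1 : t < 1 / 2)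
    {good : G → Prop} {k N : ℕ} (hN : 0 < N) {u : ι → G}
    (H : ∀ U : Finset ι, #U = k → (∀ i ∈ U, good (u i)) →
      N ≤ #(U.powerset.image fun T => ∑ i ∈ T, u i)) :
    ∀ (R : ℕ) (S : Finset ι), k * R ≤ #S → (∀ i ∈ S, good (u i)) → ∀ s,
      conc t S u s ≤ 1 / N + (1 - t ^ k) ^ R := by
  have htk : t ^ k ≤ 1 := pow_le_one₀ h0.le (by linarith)
  have htk0 : 0 < t ^ k := pow_pos h0 _
  intro R
  induction R with
  | zero =>
    intro S _ _ s
    have : (0 : ℝ) ≤ 1 / N := by positivity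
    have := conc_le_one h0.le (by linarith : t ≤ 1) S u s
    simp only [pow_zero]; linarith
  | succ R ih =>
    intro S hS hg s
    obtain ⟨U, hUS, hU⟩ := exists_subset_card_eq (s := S) (n := k) (by nlinarith)
    have hcard : k * R ≤ #(S \ U) := by
      rw [card_sdiff_of_subset hUS, hU]
      have : k * (R + 1) = k * R + k := by ring
      omega
    have ih' := ih (S \ U) hcard fun i hi => hg i (Finset.mem_sdiff.1 hi).1
    set β : ℝ := 1 / N + (1 - t ^ k) ^ R
    have hV := H U hU fun i hi => hg i (hUS hi)
    set V := U.powerset.image fun T => ∑ i ∈ T, u i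
    obtain ⟨T₀, hT₀, hle⟩ : ∃ T₀ ∈ U.powerset,
        conc t (S \ U) u (s - ∑ i ∈ T₀, u i) ≤ 1 / N := by
      by_contra! hcon
      have hV0 : V.Nonempty := card_pos.1 (by omega)
      have h2 : ∑ v ∈ V, (1 / N : ℝ) < ∑ v ∈ V, conc t (S \ U) u (s - v) := by
        refine sum_lt_sum_of_nonempty hV0 fun v hv => ?_
        obtain ⟨T, hT, rfl⟩ := mem_image.1 hv
        exact hcon T hT
      have h3 : ∑ v ∈ V, conc t (S \ U) u (s - v) ≤ 1 := by
        have := sum_conc_le_one h0.le (by linarith : t ≤ 1) (S \ U) u (V.image fun v => s - v)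
        rwa [sum_image (fun a _ b _ h => by simpa using h)] at this
      rw [sum_const, nsmul_eq_mul] at h2
      have hN' : (0 : ℝ) < N := by exact_mod_cast hN
      have h4 : (N : ℝ) ≤ #V := by exact_mod_cast hV
      have : (1 : ℝ) ≤ #V * (1 / N) := by
        rw [mul_one_div, le_div_iff₀ hN']; linarith
      linarith
    have e : S = (S \ U) ∪ U := by rw [sdiff_union_of_subset hUS]
    rw [e, conc_union sdiff_disjoint, ← add_sum_erase _ _ hT₀]
    have hw := sum_powerset_weight t U
    rw [← add_sum_erase _ _ hT₀] at hw
    set w : Finset ι → ℝ := fun T => t ^ #T * (1 - t) ^ (#U - #T)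
    have hw0 : ∀ T, 0 ≤ w T := fun T =>
      mul_nonneg (pow_nonneg h0.le _) (pow_nonneg (by linarith) _)
    have hsum : ∑ T ∈ U.powerset.erase T₀, w T * conc t (S \ U) u (s - ∑ i ∈ T, u i)
        ≤ (∑ T ∈ U.powerset.erase T₀, w T) * β := by
      rw [sum_mul]
      exact sum_le_sum fun T _ => mul_le_mul_of_nonneg_left (ih' _) (hw0 T)
    have hwT : t ^ k ≤ w T₀ := by
      have hc : #T₀ + (#U - #T₀) = k := by
        rw [hU]
        have := card_le_card (mem_powerset.1 hT₀)
        omega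
      rw [← hc, pow_add]
      exact mul_le_mul_of_nonneg_left (pow_le_pow_left₀ h0.le (by linarith) _) (pow_nonneg h0.le _)
    have hw' : (∑ T ∈ U.powerset.erase T₀, w T) = 1 - w T₀ := by
      change w T₀ + _ = 1 at hw; linarith
    rw [hw'] at hsum
    have hβ : 1 / (N : ℝ) ≤ β := le_add_of_nonneg_right (pow_nonneg (by linarith) _)
    have h5 : w T₀ * conc t (S \ U) u (s - ∑ i ∈ T₀, u i) ≤ w T₀ * (1 / N) :=
      mul_le_mul_of_nonneg_left hle (hw0 _)
    have h6 : w T₀ * (1 / N) + (1 - w T₀) * β ≤ 1 / N + (1 - t ^ k) ^ (R + 1) := by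
      have : (1 - t ^ k) ^ R = β - 1 / N := by simp [β]
      rw [pow_succ, this]
      nlinarith
    exact (add_le_add h5 hsum).trans h6

lemma image_subsetSums_insert [DecidableEq ι] [DecidableEq G] {U : Finset ι} {a : ι} (ha : a ∉ U)
    (u : ι → G) :
    ((insert a U).powerset.image fun T => ∑ i ∈ T, u i) =
      (U.powerset.image fun T => ∑ i ∈ T, u i) ∪
        (U.powerset.image fun T => ∑ i ∈ T, u i).image (u a + ·) := by
  rw [powerset_insert, image_union, image_image, image_image]
  congr 1
  refine image_congr fun T hT => ?_
  have : a ∉ T := fun h => ha (mem_powerset.1 hT h)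
  simp [sum_insert this]

lemma card_subsetSums_rat [DecidableEq ι] (u : ι → ℚ) (U : Finset ι) (hU : ∀ i ∈ U, u i ≠ 0) :
    #U + 1 ≤ #(U.powerset.image fun T => ∑ i ∈ T, u i) := by
  induction U using Finset.induction_on with
  | empty => simp
  | insert a U ha ih =>
    rw [image_subsetSums_insert ha, card_insert_of_notMem ha]
    set V := U.powerset.image fun T => ∑ i ∈ T, u i
    have hV := ih fun i hi => hU i (mem_insert_of_mem hi)
    have hVn : V.Nonempty := card_pos.1 (by omega)
    refine (Nat.succ_le_succ hV).trans (Nat.succ_le_of_lt (card_lt_card ?_))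
    refine ⟨subset_union_left, fun hsub => ?_⟩
    have hmem : ∀ v ∈ V, u a + v ∈ V := fun v hv =>
      hsub (mem_union_right _ (mem_image_of_mem _ hv))
    rcases lt_or_gt_of_ne (hU a (mem_insert_self _ _)) with h | h
    · have := V.min'_le _ (hmem _ (V.min'_mem hVn)); linarith
    · have := V.le_max' _ (hmem _ (V.max'_mem hVn)); linarith

lemma card_subsetSums_zmod [DecidableEq ι] (N : ℕ) [NeZero N] (u : ι → ZMod N) (U : Finset ι)
    (hU : ∀ i ∈ U, IsUnit (u i)) :
    min N (#U + 1) ≤ #(U.powerset.image fun T => ∑ i ∈ T, u i) := by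
  induction U using Finset.induction_on with
  | empty => simp
  | insert a U ha ih =>
    rw [image_subsetSums_insert ha, card_insert_of_notMem ha]
    set V := U.powerset.image fun T => ∑ i ∈ T, u i
    have hV := ih fun i hi => hU i (mem_insert_of_mem hi)
    have h0 : (0 : ZMod N) ∈ V := mem_image.2 ⟨∅, by simp, by simp⟩
    by_cases hsub : V.image (u a + ·) ⊆ V
    · have hall : ∀ k : ℕ, (k : ZMod N) * u a ∈ V := by
        intro k
        induction k with
        | zero => simpa using h0
        | succ k ihk =>
          have := hsub (mem_image_of_mem _ ihk)
          push_cast; rwa [add_mul, one_mul, add_comm]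
      obtain ⟨c, hc⟩ := hU a (mem_insert_self _ _)
      have : V = univ := by
        refine eq_univ_iff_forall.2 fun x => ?_
        have := hall (x * (c⁻¹ : (ZMod N)ˣ)).val
        rwa [ZMod.natCast_zmod_val, ← hc, mul_assoc, Units.inv_mul, mul_one] at this
      rw [this]
      simp [ZMod.card]
    · have : #V < #(V ∪ V.image (u a + ·)) :=
        card_lt_card ⟨subset_union_left, fun h => hsub (subset_union_right.trans h)⟩
      omega

/-- Littlewood–Offord: sums with many nonzero rational coefficients have no large atoms. -/
lemma exists_conc_rat_le (h0 : 0 < t) (h1 : t < 1 / 2) {ε : ℝ} (hε : 0 < ε) :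
    ∃ r : ℕ, ∀ (m : ℕ) (B : Finset (Fin m)) (c : Fin m → ℚ), r ≤ #{l ∈ B | c l ≠ 0} →
      ∀ s, conc t B c s ≤ ε := by
  obtain ⟨k, hk⟩ := exists_nat_one_div_lt (half_pos hε)
  have htk0 : 0 < t ^ k := pow_pos h0 _
  obtain ⟨R, hR⟩ := exists_pow_lt_of_lt_one (half_pos hε) (by linarith : 1 - t ^ k < 1)
  have ht : t ≤ 1 := by linarith
  refine ⟨k * R, fun m B c hB => conc_mono_bound (S := {l ∈ B | c l ≠ 0}) h0.le ht
    (filter_subset _ B) fun s => ?_⟩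
  have := conc_le_of_subsetSums h0 h1 (good := fun x : ℚ => x ≠ 0) (k := k) (N := k + 1)
    (Nat.succ_pos k) (u := c) (fun U hU hg => hU ▸ card_subsetSums_rat c U hg) R _ hB
    (fun i hi => (mem_filter.1 hi).2) s
  push_cast at this
  linarith

open scoped Classical in
/-- Number of coordinates of a vector that are units. -/
noncomputable def unitCount {n Q : ℕ} (u : Fin n → ZMod Q) : ℕ := #{i | IsUnit (u i)}

open scoped Classical in
/-- A sum with linearly many unit steps is nearly equidistributed modulo a fixed `N`. -/
lemma eventually_conc_zmod_le (h0 : 0 < t) (h1 : t < 1 / 2) (N : ℕ) [NeZero N] {c₀ : ℝ}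
    (hc₀ : 0 < c₀) :
    ∀ᶠ n : ℕ in atTop, ∀ u : Fin n → ZMod N, c₀ * n ≤ unitCount u →
      ∀ s, conc t univ u s ≤ 2 / N := by
  have hN : 0 < N := NeZero.pos N
  have hN' : (0 : ℝ) < N := by exact_mod_cast hN
  have htk0 : 0 < t ^ N := pow_pos h0 _
  obtain ⟨R, hR⟩ := exists_pow_lt_of_lt_one (by positivity : (0 : ℝ) < 1 / N)
    (by linarith : 1 - t ^ N < 1)
  filter_upwards [(tendsto_natCast_atTop_atTop (R := ℝ)).eventually_ge_atTop (N * R / c₀)]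
    with n hn u hu s
  rw [div_le_iff₀ hc₀] at hn
  have hc : N * R ≤ #{i | IsUnit (u i)} := by
    have : ((N * R : ℕ) : ℝ) ≤ unitCount u := by push_cast; linarith
    refine (Nat.cast_le.1 this).trans_eq ?_
    unfold unitCount
    congr
  have ht : t ≤ 1 := by linarith
  refine conc_mono_bound (S := {i | IsUnit (u i)}) h0.le ht (subset_univ _) (fun s => ?_) s
  have := conc_le_of_subsetSums h0 h1 (good := IsUnit) (k := N) (N := N) hN (u := u)
    (fun U hU hg => by
      have := card_subsetSums_zmod N u U hg
      rwa [hU, min_eq_left (Nat.le_succ N)] at this) R _ hc (fun i hi => (mem_filter.1 hi).2) s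
  have e : (2 : ℝ) / N = 1 / N + 1 / N := by ring
  linarith

end Conc

end

section

/-! ### Row weights and test functions -/

/-- Probability that a vector of independent Bernoulli(`t`) variables equals `x`. -/
noncomputable def rowWeight {ι : Type*} [Fintype ι] (t : ℝ) (x : ι → Bool) : ℝ :=
  ∏ j, if x j then t else 1 - t

/-- Pairing of a `0`/`1` vector with a vector of group elements. -/
def subsetSum {ι G : Type*} [Fintype ι] [AddCommGroup G] (x : ι → Bool) (u : ι → G) : G :=
  ∑ j, if x j then u j else 0

section Basic

variable {ι G : Type*} [Fintype ι] [AddCommGroup G] {t : ℝ}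

lemma rowWeight_nonneg (h0 : 0 ≤ t) (h1 : t ≤ 1) (x : ι → Bool) : 0 ≤ rowWeight t x :=
  prod_nonneg fun j _ => by split_ifs <;> linarith

lemma sum_rowWeight [DecidableEq ι] (t : ℝ) : ∑ x : ι → Bool, rowWeight t x = 1 := by
  unfold rowWeight
  have := Finset.prod_univ_sum (fun _ : ι => (univ : Finset Bool))
    (fun _ b => if b then t else 1 - t)
  rw [Fintype.piFinset_univ] at this
  rw [← this]
  simp

lemma subsetSum_add (x : ι → Bool) (u v : ι → G) :
    subsetSum x (u + v) = subsetSum x u + subsetSum x v := by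
  unfold subsetSum
  rw [← sum_add_distrib]
  exact sum_congr rfl fun j _ => by by_cases h : x j <;> simp [h]

lemma subsetSum_map {H : Type*} [AddCommGroup H] (f : G →+ H) (x : ι → Bool) (u : ι → G) :
    subsetSum x (fun j => f (u j)) = f (subsetSum x u) := by
  unfold subsetSum
  rw [map_sum]
  exact sum_congr rfl fun j _ => by by_cases h : x j <;> simp [h]

lemma subsetSum_mul {R : Type*} [CommRing R] (k : R) (x : ι → Bool) (u : ι → R) :
    subsetSum x (fun j => k * u j) = k * subsetSum x u :=
  subsetSum_map (AddMonoidHom.mulLeft k) x u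

lemma sum_rowWeight_mul_ite [DecidableEq ι] [DecidableEq G] (u : ι → G) (s : G) :
    ∑ x : ι → Bool, rowWeight t x * (if subsetSum x u = s then 1 else 0) =
      conc t univ u s := by
  classical
  unfold conc
  refine sum_bij' (fun x _ => univ.filter fun i => x i = true) (fun T _ i => decide (i ∈ T))
    ?_ ?_ ?_ ?_ ?_
  · simp
  · simp
  · intro x _; ext i; simp
  · intro T _; ext i; simp
  · intro x _
    have e1 : rowWeight t x = t ^ #{i | x i = true} *
        (1 - t) ^ (#(univ : Finset ι) - #{i | x i = true}) := by
      unfold rowWeight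
      rw [prod_ite, prod_const, prod_const, ← card_filter_add_card_filter_not (s := univ)
        (fun i => x i = true), Nat.add_sub_cancel_left]
    have e2 : subsetSum x u = ∑ i ∈ univ.filter (fun i => x i = true), u i := by
      unfold subsetSum
      rw [sum_filter]
    rw [e1, e2]
    congr

end Basic

/-! ### A signed test function modulo `Q` -/

section Test

variable {Q : ℕ} [NeZero Q]

/-- Difference of `Q` times the indicator of `0` and the counting function of `b ↦ T b`. -/
noncomputable def testFun (Q : ℕ) [NeZero Q] (T : ℕ) (z : ZMod Q) : ℝ :=
  ∑ b : ZMod Q, ((if z = 0 then 1 else 0) - (if z = T * b then 1 else 0))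

/-- Nonnegative majorant of `testFun`. -/
noncomputable def testMajorant (Q : ℕ) [NeZero Q] (T : ℕ) (z : ZMod Q) : ℝ :=
  ∑ b : ZMod Q, ((if z = 0 then 1 else 0) + (if z = T * b then 1 else 0))

lemma abs_testFun_le (T : ℕ) (z : ZMod Q) : |testFun Q T z| ≤ Q := by
  refine (abs_sum_le_sum_abs _ _).trans ?_
  have : ∀ b ∈ (univ : Finset (ZMod Q)),
      |((if z = 0 then 1 else 0) - (if z = T * b then 1 else 0) : ℝ)| ≤ 1 := by
    intro b _
    split_ifs <;> simp
  simpa [ZMod.card] using sum_le_sum this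

lemma abs_testFun_le_testMajorant (T : ℕ) (z : ZMod Q) : |testFun Q T z| ≤ testMajorant Q T z := by
  refine (abs_sum_le_sum_abs _ _).trans (sum_le_sum fun b _ => ?_)
  split_ifs <;> simp

lemma testMajorant_nonneg (T : ℕ) (z : ZMod Q) : 0 ≤ testMajorant Q T z :=
  (abs_nonneg _).trans (abs_testFun_le_testMajorant T z)

lemma sum_testFun_add_mul {T : ℕ} {D c : ZMod Q} (h : (T : ZMod Q) = D * c) (z : ZMod Q) :
    ∑ k : ZMod Q, testFun Q T (z + k * D) = 0 := by
  unfold testFun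
  rw [sum_comm]
  refine sum_eq_zero fun b _ => ?_
  rw [sum_sub_distrib, sub_eq_zero]
  refine (Equiv.sum_comp (Equiv.subRight (c * b))
    (fun k : ZMod Q => if z + k * D = 0 then (1 : ℝ) else 0)).symm.trans ?_
  refine sum_congr rfl fun k _ => ?_
  have : z + (k - c * b) * D = 0 ↔ z + k * D = T * b := by
    rw [h, ← sub_eq_zero (b := D * c * b)]
    ring_nf
  simp only [Equiv.subRight_apply, this]

lemma card_mul_eq_zero_le {T : ℕ} (hT : 0 < T) : #{k : ZMod Q | k * T = 0} ≤ T := by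
  have := IsAddCyclic.card_nsmul_eq_zero_le (α := ZMod Q) hT
  simpa [mul_comm] using this

lemma card_mul_eq_le {T : ℕ} (hT : 0 < T) {D c : ZMod Q} (h : (T : ZMod Q) = D * c)
    (y : ZMod Q) : #{k : ZMod Q | k * D = y} ≤ T := by
  refine le_trans ?_ (card_mul_eq_zero_le (Q := Q) hT)
  rcases (univ.filter fun k : ZMod Q => k * D = y).eq_empty_or_nonempty with he | ⟨k₀, hk₀⟩
  · simp [he]
  refine card_le_card_of_injOn (fun k => k - k₀) (fun k hk => ?_) (fun a _ b _ hab => by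
    simpa using hab)
  have hk : k * D = y := by simpa using hk
  have hk₀ : k₀ * D = y := by simpa using hk₀
  have : (k - k₀) * T = 0 := by
    rw [h, ← mul_assoc, sub_mul, hk, hk₀, sub_self, zero_mul]
  simpa using this

lemma sum_testMajorant_add_mul_le {T : ℕ} (hT : 0 < T) {D c : ZMod Q}
    (h : (T : ZMod Q) = D * c) (z : ZMod Q) :
    ∑ k : ZMod Q, testMajorant Q T (z + k * D) ≤ Q * (2 * T) := by
  have key : ∀ y : ZMod Q, ∑ k : ZMod Q, (if z + k * D = y then (1 : ℝ) else 0) ≤ T := by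
    intro y
    have : ∀ k : ZMod Q, z + k * D = y ↔ k * D = y - z := fun k => by
      rw [eq_sub_iff_add_eq, add_comm]
    simp only [this, sum_boole]
    exact_mod_cast card_mul_eq_le hT h _
  unfold testMajorant
  rw [sum_comm]
  calc _ ≤ ∑ b : ZMod Q, (2 * T : ℝ) := sum_le_sum fun b _ => by
        rw [sum_add_distrib]; linarith [key 0, key (T * b)]
    _ = _ := by simp [ZMod.card]

end Test

end

section

/-! ### Averaging over translates -/

section Averaging

variable {Q : ℕ} [NeZero Q] {ι κ : Type*} [Fintype ι] [DecidableEq ι]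

lemma sum_sum_add_mul (f : (ι → ZMod Q) → ℝ) (E : ι → ZMod Q) :
    ∑ u, ∑ k : ZMod Q, f (u + fun j => k * E j) = Q * ∑ u, f u := by
  rw [sum_comm]
  have : ∀ k : ZMod Q, ∑ u, f (u + fun j => k * E j) = ∑ u, f u := fun k =>
    Equiv.sum_comp (Equiv.addRight (fun j => k * E j)) f
  simp [this, ZMod.card]

lemma sum_prod_testFun_eq_zero [Fintype κ] [DecidableEq κ] {T : ℕ} {D c : ZMod Q}
    (h : (T : ZMod Q) = D * c)
    (X : κ → ι → Bool) (E : ι → ZMod Q) (l : κ) (hl : subsetSum (X l) E = D)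
    (hne : ∀ i, i ≠ l → subsetSum (X i) E = 0) :
    ∑ u : ι → ZMod Q, ∏ i, testFun Q T (subsetSum (X i) u) = 0 := by
  have hQ : (Q : ℝ) ≠ 0 := by exact_mod_cast NeZero.ne Q
  refine (mul_eq_zero.1 ?_).resolve_left hQ
  rw [← sum_sum_add_mul _ E]
  refine sum_eq_zero fun u _ => ?_
  have : ∀ k : ZMod Q, ∏ i, testFun Q T (subsetSum (X i) (u + fun j => k * E j)) =
      (∏ i ∈ univ.erase l, testFun Q T (subsetSum (X i) u)) *
        testFun Q T (subsetSum (X l) u + k * D) := by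
    intro k
    rw [← prod_erase_mul _ _ (mem_univ l), subsetSum_add, subsetSum_mul, hl]
    congr 1
    refine prod_congr rfl fun i hi => ?_
    rw [subsetSum_add, subsetSum_mul, hne i (ne_of_mem_erase hi), mul_zero, add_zero]
  simp_rw [this, ← mul_sum]
  rw [sum_testFun_add_mul h, mul_zero]

lemma sum_prod_testMajorant_le [DecidableEq κ] {T : ℕ} (hT : 0 < T) (X : κ → ι → Bool)
    (B : Finset κ)
    (D c : ZMod Q) (h : (T : ZMod Q) = D * c) (E : κ → ι → ZMod Q)
    (hE : ∀ l ∈ B, ∀ i ∈ B, subsetSum (X i) (E l) = if i = l then D else 0) :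
    ∑ u : ι → ZMod Q, ∏ i ∈ B, testMajorant Q T (subsetSum (X i) u) ≤
      (Q : ℝ) ^ Fintype.card ι * (2 * T) ^ #B := by
  have hQ : (0 : ℝ) < Q := by exact_mod_cast NeZero.pos Q
  induction B using Finset.induction_on with
  | empty => simp [ZMod.card]
  | insert l B hl ih =>
    have ih' := ih fun a ha i hi => hE a (mem_insert_of_mem ha) i (mem_insert_of_mem hi)
    refine le_of_mul_le_mul_left ?_ hQ
    rw [← sum_sum_add_mul _ (E l)]
    have key : ∀ u : ι → ZMod Q,
        ∑ k : ZMod Q, ∏ i ∈ insert l B,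
            testMajorant Q T (subsetSum (X i) (u + fun j => k * E l j)) ≤
          (∏ i ∈ B, testMajorant Q T (subsetSum (X i) u)) * (Q * (2 * T)) := by
      intro u
      have : ∀ k : ZMod Q,
          ∏ i ∈ insert l B, testMajorant Q T (subsetSum (X i) (u + fun j => k * E l j)) =
            (∏ i ∈ B, testMajorant Q T (subsetSum (X i) u)) *
              testMajorant Q T (subsetSum (X l) u + k * D) := by
        intro k
        rw [prod_insert hl, mul_comm, subsetSum_add, subsetSum_mul,
          hE l (mem_insert_self _ _) l (mem_insert_self _ _), if_pos rfl]
        congr 1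
        refine prod_congr rfl fun i hi => ?_
        rw [subsetSum_add, subsetSum_mul, hE l (mem_insert_self _ _) i (mem_insert_of_mem hi),
          if_neg (ne_of_mem_of_not_mem hi hl), mul_zero, add_zero]
      simp_rw [this, ← mul_sum]
      exact mul_le_mul_of_nonneg_left (sum_testMajorant_add_mul_le hT h _)
        (prod_nonneg fun i _ => testMajorant_nonneg _ _)
    refine (sum_le_sum fun u _ => key u).trans ?_
    rw [← sum_mul, card_insert_of_notMem hl, pow_succ]
    calc _ ≤ (Q : ℝ) ^ Fintype.card ι * (2 * T) ^ #B * (Q * (2 * T)) :=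
          mul_le_mul_of_nonneg_right ih' (by positivity)
      _ = _ := by ring

lemma sum_prod_testFun_le [Fintype κ] [DecidableEq κ] {T : ℕ} (hT : 0 < T) (X : κ → ι → Bool)
    (B : Finset κ) (D c : ZMod Q) (h : (T : ZMod Q) = D * c) (E : κ → ι → ZMod Q)
    (hE : ∀ l ∈ B, ∀ i ∈ B, subsetSum (X i) (E l) = if i = l then D else 0) :
    ∑ u : ι → ZMod Q, ∏ i, testFun Q T (subsetSum (X i) u) ≤
      (Q : ℝ) ^ #Bᶜ * ((Q : ℝ) ^ Fintype.card ι * (2 * T) ^ #B) := by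
  refine le_trans (sum_le_sum fun u _ => ?_) (le_trans (mul_sum _ _ _).ge
    (mul_le_mul_of_nonneg_left (sum_prod_testMajorant_le hT X B D c h E hE) (by positivity)))
  refine (le_abs_self _).trans ?_
  rw [abs_prod, ← prod_mul_prod_compl B, mul_comm]
  refine mul_le_mul ?_ (prod_le_prod (fun _ _ => abs_nonneg _) fun i _ =>
    abs_testFun_le_testMajorant _ _) (prod_nonneg fun _ _ => abs_nonneg _) (by positivity)
  rw [← prod_const]
  exact prod_le_prod (fun _ _ => abs_nonneg _) fun i _ => abs_testFun_le _ _

end Averaging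

/-- Rational linear algebra of the rows of a `0`/`1` matrix with column set `𝒮`: a row basis `B`,
the coefficients of all rows, and an integral dual basis up to the factor `D`. -/
lemma exists_rowBasis {m : ℕ} (𝒮 : Finset (Fin m → Bool)) :
    ∃ (B : Finset (Fin m)) (c : Fin m → Fin m → ℚ) (e : Fin m → (Fin m → Bool) → ℤ) (D : ℤ),
      D ≠ 0 ∧
      (∀ s ∈ 𝒮, ∀ i, (if s i then (1 : ℚ) else 0) = ∑ l ∈ B, if s l then c i l else 0) ∧
      ∀ l ∈ B, ∀ i ∈ B, (∑ s ∈ 𝒮, if s i then e l s else 0) = if i = l then D else 0 := by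
  classical
  let R : Fin m → (𝒮 → ℚ) := fun i s => if s.1 i then 1 else 0
  obtain ⟨b, -, -, hspan, hli⟩ := exists_linearIndepOn_extension (K := ℚ) (v := R)
    (linearIndepOn_empty ℚ R) (Set.empty_subset Set.univ)
  set B : Finset (Fin m) := b.toFinset with hB
  have hbB : (B : Set (Fin m)) = b := by simp [hB]
  have hc : ∀ i, ∃ c : Fin m → ℚ, ∑ l ∈ B, c l • R l = R i := by
    intro i
    have : R i ∈ Submodule.span ℚ (R '' (B : Set (Fin m))) := by
      rw [hbB]; exact hspan (Set.mem_image_of_mem _ (Set.mem_univ i))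
    obtain ⟨c, hc⟩ := (Submodule.mem_span_image_finset_iff_exists_fun ℚ).1 this
    refine ⟨fun l => if h : l ∈ B then c ⟨l, h⟩ else 0, ?_⟩
    rw [← hc, ← sum_coe_sort]
    exact sum_congr rfl fun l _ => by simp
  choose c hc using hc
  have hdual : ∀ l : b, ∃ f : (𝒮 → ℚ) →ₗ[ℚ] ℚ, ∀ i : b, f (R i) = if i = l then 1 else 0 := by
    intro l
    obtain ⟨f, hf⟩ := LinearMap.exists_extend
      ((Finsupp.lapply l).comp (LinearIndependent.repr hli) : _ →ₗ[ℚ] ℚ)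
    refine ⟨f, fun i => ?_⟩
    have hmem : R i ∈ Submodule.span ℚ (Set.range fun x : b => R x) :=
      Submodule.subset_span ⟨i, rfl⟩
    have h1 := LinearMap.congr_fun hf ⟨R i, hmem⟩
    have h2 := LinearIndependent.repr_eq_single hli i ⟨R i, hmem⟩ rfl
    simp only [LinearMap.comp_apply, Submodule.subtype_apply, Finsupp.lapply_apply] at h1
    rw [h1]
    erw [h2]
    simp [Finsupp.single_apply]
  choose f hf using hdual
  obtain ⟨D, hD⟩ := IsLocalization.exist_integer_multiples_of_finite (nonZeroDivisors ℤ)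
    (fun p : b × 𝒮 => f p.1 (Pi.single p.2 1))
  choose g hg using hD
  refine ⟨B, c, fun l s => if h : l ∈ b ∧ s ∈ 𝒮 then g (⟨l, h.1⟩, ⟨s, h.2⟩) else 0, D,
    nonZeroDivisors.coe_ne_zero D, ?_, ?_⟩
  · intro s hs i
    have := congrFun (hc i) ⟨s, hs⟩
    rw [Finset.sum_apply] at this
    simp only [R, Pi.smul_apply, smul_eq_mul, mul_ite, mul_one, mul_zero] at this
    exact this.symm
  · intro l hl i hi
    have hl : l ∈ b := by rw [← hbB]; exact hl
    have hi : i ∈ b := by rw [← hbB]; exact hi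
    have h1 := hf ⟨l, hl⟩ ⟨i, hi⟩
    have h2 : R i = ∑ s : 𝒮, R i s • (Pi.single s 1 : 𝒮 → ℚ) := by
      ext s; simp [Finset.sum_apply, Pi.single_apply]
    have h3 : (D : ℚ) * f ⟨l, hl⟩ (R i) = ∑ s : 𝒮, if s.1 i then (g (⟨l, hl⟩, s) : ℚ) else 0 := by
      rw [h2, map_sum, mul_sum]
      refine sum_congr rfl fun s _ => ?_
      have := hg (⟨l, hl⟩, s)
      simp at this
      rw [map_smul, this]
      by_cases h : s.1 i <;> simp [R, h]
    have h4 : (∑ s ∈ 𝒮, if s i then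
        (if h : l ∈ b ∧ s ∈ 𝒮 then g (⟨l, h.1⟩, ⟨s, h.2⟩) else 0) else 0) =
        ∑ s : 𝒮, if s.1 i then g (⟨l, hl⟩, s) else 0 := by
      rw [← sum_coe_sort]
      exact sum_congr rfl fun s _ => by simp [hl]
    rw [h4]
    rw [h1] at h3
    have h5 : ((if i = l then (D : ℤ) else 0 : ℤ) : ℚ) =
        ((∑ s : 𝒮, if s.1 i then g (⟨l, hl⟩, s) else 0 : ℤ) : ℚ) := by
      push_cast
      rw [← h3]
      by_cases h : i = l <;> simp [h]
    exact_mod_cast h5.symm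

end

section

/-! ### Column sets and their linear span -/

/-- The set of columns of a `0`/`1` matrix. -/
def columnSet {ι κ : Type*} [Fintype ι] [Fintype κ] [DecidableEq κ] (X : κ → ι → Bool) :
    Finset (κ → Bool) :=
  univ.image fun j i => X i j

lemma exists_lift_columnSet {m n : ℕ} (X : Fin m → Fin n → Bool) (e : (Fin m → Bool) → ℤ) :
    ∃ E : Fin n → ℤ, ∀ i, subsetSum (X i) E = ∑ s ∈ columnSet X, if s i then e s else 0 := by
  classical
  have hrep : ∀ s : columnSet X, ∃ j : Fin n, (fun i => X i j) = s.1 := fun s => by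
    obtain ⟨j, -, hj⟩ := mem_image.1 s.2
    exact ⟨j, hj⟩
  choose rep hrep using hrep
  have hmem : ∀ j, (fun i => X i j) ∈ columnSet X := fun j => mem_image_of_mem _ (mem_univ j)
  refine ⟨fun j => if j = rep ⟨_, hmem j⟩ then e (fun i => X i j) else 0, fun i => ?_⟩
  have hinj : Function.Injective rep := fun s s' h => by
    apply Subtype.ext
    rw [← hrep s, ← hrep s', h]
  have hself : ∀ s, (⟨_, hmem (rep s)⟩ : columnSet X) = s := fun s => Subtype.ext (hrep s)
  rw [← sum_coe_sort]
  unfold subsetSum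
  have h1 : ∑ j ∈ univ.image rep, (if X i j = true then
      (if j = rep ⟨_, hmem j⟩ then e (fun i => X i j) else 0) else 0) =
      ∑ j, (if X i j = true then
      (if j = rep ⟨_, hmem j⟩ then e (fun i => X i j) else 0) else 0) := by
    refine sum_subset (subset_univ _) fun j _ hj => ?_
    have : j ≠ rep ⟨_, hmem j⟩ := fun h => hj (mem_image.2 ⟨_, mem_univ _, h.symm⟩)
    simp [this]
  rw [← h1, sum_image fun a _ b _ hab => hinj hab]
  refine sum_congr rfl fun s _ => ?_
  rw [hself s, if_pos rfl, hrep s, congrFun (hrep s) i]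

lemma exists_mul_eq_three_pow {D : ℤ} (hD : D ≠ 0) {t₀ : ℕ} (hlt : D.natAbs < 3 ^ t₀) (j : ℕ) :
    ∃ c : ZMod (3 ^ j), ((3 ^ t₀ : ℕ) : ZMod (3 ^ j)) = (D : ZMod (3 ^ j)) * c := by
  have hg : Int.gcd D (3 ^ j : ℕ) ∣ 3 ^ j := by
    have := Int.gcd_dvd_right D (3 ^ j : ℕ)
    exact_mod_cast this
  obtain ⟨i, -, hi⟩ := (Nat.dvd_prime_pow Nat.prime_three).1 hg
  have hle : 3 ^ i ≤ D.natAbs := by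
    rw [← hi]
    exact Nat.le_of_dvd (Int.natAbs_pos.2 hD) (Int.natAbs_dvd_natAbs.2 (Int.gcd_dvd_left D _))
  have hit : i ≤ t₀ := (Nat.pow_lt_pow_iff_right (by norm_num)).1 (hle.trans_lt hlt) |>.le
  have hb := Int.gcd_eq_gcd_ab D (3 ^ j : ℕ)
  rw [hi] at hb
  refine ⟨(Int.gcdA D (3 ^ j : ℕ) : ZMod (3 ^ j)) * 3 ^ (t₀ - i), ?_⟩
  have h2 : ((3 ^ i : ℕ) : ZMod (3 ^ j)) = (D : ZMod (3 ^ j)) * (Int.gcdA D (3 ^ j : ℕ)) := by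
    have h3 := congrArg (fun z : ℤ => (z : ZMod (3 ^ j))) hb
    have h0 : ((3 ^ j : ℕ) : ZMod (3 ^ j)) = 0 := ZMod.natCast_self _
    simp only [Int.cast_natCast, Int.cast_add, Int.cast_mul] at h3
    rw [h3, h0, zero_mul, add_zero]
  rw [← mul_assoc, ← h2, ← Nat.add_sub_cancel' hit]
  push_cast
  rw [pow_add, Nat.add_sub_cancel_left]

variable {t : ℝ}

lemma sum_prod_le_of_columnSet {m n : ℕ} (h0 : 0 ≤ t) (h1 : t ≤ 1) (𝒮 : Finset (Fin m → Bool))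
    (B : Finset (Fin m)) {h : (Fin n → Bool) → ℝ} {α : ℝ} (hh0 : ∀ x, 0 ≤ h x)
    (hhw : ∀ x, h x ≤ rowWeight t x) (hhα : ∀ x, h x ≤ α) :
    ∑ X : Fin m → Fin n → Bool with columnSet X = 𝒮, ∏ i, h (X i) ≤
      α ^ #Bᶜ * (∑ s ∈ 𝒮, ∏ l ∈ B, if s l then t else 1 - t) ^ n := by
  have hα : 0 ≤ α := (hh0 fun _ => false).trans (hhα _)
  have hsum : (∑ s ∈ 𝒮, ∏ l ∈ B, if s l then t else 1 - t) ^ n =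
      ∑ p ∈ Fintype.piFinset (fun _ : Fin n => 𝒮), ∏ j, ∏ l ∈ B, if p j l then t else 1 - t := by
    have := Finset.prod_univ_sum (fun _ : Fin n => 𝒮)
      (fun _ s => ∏ l ∈ B, if s l then t else 1 - t)
    rw [← this]
    simp
  rw [hsum, mul_sum]
  have hpt : ∀ X : Fin m → Fin n → Bool, ∏ i, h (X i) ≤
      α ^ #Bᶜ * ∏ j, ∏ l ∈ B, if X l j then t else 1 - t := by
    intro X
    rw [← prod_mul_prod_compl B, mul_comm, Finset.prod_comm]
    refine mul_le_mul ?_ (prod_le_prod (fun _ _ => hh0 _) fun i _ => hhw _)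
      (prod_nonneg fun _ _ => hh0 _) (by positivity)
    rw [← prod_const]
    exact prod_le_prod (fun _ _ => hh0 _) fun i _ => hhα _
  refine (sum_le_sum fun X _ => hpt X).trans ?_
  have hmap := sum_map (univ.filter fun X : Fin m → Fin n → Bool => columnSet X = 𝒮)
    (Equiv.piComm fun _ _ => Bool).toEmbedding
    (fun p : Fin n → Fin m → Bool => α ^ #Bᶜ * ∏ j, ∏ l ∈ B, if p j l then t else 1 - t)
  refine hmap.symm.le.trans (sum_le_sum_of_subset_of_nonneg (fun p hp => ?_) fun p _ _ =>
    mul_nonneg (by positivity) (prod_nonneg fun j _ => prod_nonneg fun l _ => ?_))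
  · obtain ⟨X, hX, rfl⟩ := mem_map.1 hp
    rw [Fintype.mem_piFinset]
    intro j
    rw [← (mem_filter.1 hX).2]
    exact mem_image_of_mem _ (mem_univ j)
  · split_ifs <;> linarith

section Span

variable {m : ℕ} {𝒮 : Finset (Fin m → Bool)} {B : Finset (Fin m)} {c : Fin m → Fin m → ℚ}

lemma prod_ite_eq_pow (B : Finset (Fin m)) (s : Fin m → Bool) :
    (∏ l ∈ B, if s l then t else 1 - t) =
      t ^ #{l ∈ B | s l = true} * (1 - t) ^ (#B - #{l ∈ B | s l = true}) := by
  rw [prod_ite, prod_const, prod_const]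
  congr 2
  have := card_filter_add_card_filter_not (s := B) (fun i => s i = true)
  omega

lemma injOn_of_rowBasis
    (hc : ∀ s ∈ 𝒮, ∀ i, (if s i then (1 : ℚ) else 0) = ∑ l ∈ B, if s l then c i l else 0) :
    Set.InjOn (fun s : Fin m → Bool => {l ∈ B | s l = true}) 𝒮 := by
  intro s hs s' hs' h
  ext i
  have h1 := hc s hs i
  have h2 := hc s' hs' i
  rw [← sum_filter] at h1 h2
  simp only at h
  rw [h, ← h2] at h1
  by_cases a : s i <;> by_cases b : s' i <;> simp_all

lemma sum_prod_le_one (h0 : 0 ≤ t) (h1 : t ≤ 1)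
    (hc : ∀ s ∈ 𝒮, ∀ i, (if s i then (1 : ℚ) else 0) = ∑ l ∈ B, if s l then c i l else 0) :
    ∑ s ∈ 𝒮, ∏ l ∈ B, (if s l then t else 1 - t) ≤ 1 := by
  classical
  simp_rw [prod_ite_eq_pow]
  rw [← sum_image (f := fun T : Finset (Fin m) => t ^ #T * (1 - t) ^ (#B - #T))
    (injOn_of_rowBasis hc)]
  have h1' : 0 ≤ 1 - t := by linarith
  refine le_trans (sum_le_sum_of_subset_of_nonneg (fun T hT => ?_) fun T _ _ =>
    mul_nonneg (pow_nonneg h0 _) (pow_nonneg h1' _)) (sum_powerset_weight t B).le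
  obtain ⟨s, -, rfl⟩ := mem_image.1 hT
  exact mem_powerset.2 (filter_subset _ _)

lemma sum_prod_le_conc (h0 : 0 ≤ t) (h1 : t ≤ 1)
    (hc : ∀ s ∈ 𝒮, ∀ i, (if s i then (1 : ℚ) else 0) = ∑ l ∈ B, if s l then c i l else 0)
    (i : Fin m) :
    ∑ s ∈ 𝒮, ∏ l ∈ B, (if s l then t else 1 - t) ≤ conc t B (c i) 0 + conc t B (c i) 1 := by
  classical
  have hw : ∀ T : Finset (Fin m), 0 ≤ t ^ #T * (1 - t) ^ (#B - #T) := fun T =>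
    mul_nonneg (pow_nonneg h0 _) (pow_nonneg (by linarith) _)
  unfold conc
  rw [← sum_add_distrib]
  have hpt : ∀ s ∈ 𝒮, (∏ l ∈ B, if s l then t else 1 - t) =
      (fun T : Finset (Fin m) => t ^ #T * (1 - t) ^ (#B - #T) *
        (if ∑ l ∈ T, c i l = 0 then 1 else 0) + t ^ #T * (1 - t) ^ (#B - #T) *
        (if ∑ l ∈ T, c i l = 1 then 1 else 0)) {l ∈ B | s l = true} := by
    intro s hs
    have := hc s hs i
    rw [← sum_filter] at this
    simp only
    rw [prod_ite_eq_pow, ← this]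
    by_cases a : s i <;> simp [a]
  rw [sum_congr rfl hpt, ← sum_image (f := fun T : Finset (Fin m) =>
        t ^ #T * (1 - t) ^ (#B - #T) *
        (if ∑ l ∈ T, c i l = 0 then 1 else 0) + t ^ #T * (1 - t) ^ (#B - #T) *
        (if ∑ l ∈ T, c i l = 1 then 1 else 0)) (injOn_of_rowBasis hc)]
  refine le_trans (sum_le_sum_of_subset_of_nonneg (t := B.powerset) (fun T hT => ?_)
    fun T _ _ => ?_) (le_of_eq (sum_congr rfl fun T _ => by congr))
  · obtain ⟨s, -, rfl⟩ := mem_image.1 hT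
    exact mem_powerset.2 (filter_subset _ _)
  · refine add_nonneg (mul_nonneg (hw _) ?_) (mul_nonneg (hw _) ?_) <;> split_ifs <;> simp

end Span

end

section

/-! ### Moment bounds -/

variable {t : ℝ}

lemma sum_dual_eq_zero {m : ℕ} {𝒮 : Finset (Fin m → Bool)} {B : Finset (Fin m)}
    {c : Fin m → Fin m → ℚ} {e : (Fin m → Bool) → ℤ} {D : ℤ} {l i : Fin m}
    (hc : ∀ s ∈ 𝒮, (if s i then (1 : ℚ) else 0) = ∑ l ∈ B, if s l then c i l else 0)
    (he : ∀ l' ∈ B, (∑ s ∈ 𝒮, if s l' then e s else 0) = if l' = l then D else 0)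
    (hil : c i l = 0) : (∑ s ∈ 𝒮, if s i then e s else 0) = 0 := by
  have h1 : ((∑ s ∈ 𝒮, if s i then e s else 0 : ℤ) : ℚ) =
      ∑ l' ∈ B, c i l' * ((∑ s ∈ 𝒮, if s l' then e s else 0 : ℤ) : ℚ) := by
    push_cast
    simp_rw [mul_sum]
    rw [sum_comm]
    refine sum_congr rfl fun s hs => ?_
    have h2 : (if s i then (e s : ℚ) else 0) = (if s i then (1 : ℚ) else 0) * e s := by
      split_ifs <;> simp
    rw [h2, hc s hs, sum_mul]
    exact sum_congr rfl fun l' _ => by split_ifs <;> simp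
  have h3 : ∑ l' ∈ B, c i l' * ((∑ s ∈ 𝒮, if s l' then e s else 0 : ℤ) : ℚ) = 0 := by
    refine sum_eq_zero fun l' hl' => ?_
    rw [he l' hl']
    by_cases h : l' = l
    · rw [h, hil, zero_mul]
    · simp [h]
  rw [h3] at h1
  exact_mod_cast h1

lemma sum_prod_mul_testFun_le {m n j t₀ k₀ r₀ : ℕ} (h0 : 0 ≤ t) (h1 : t ≤ 1)
    (𝒮 : Finset (Fin m → Bool)) {B : Finset (Fin m)} {c : Fin m → Fin m → ℚ}
    {e : Fin m → (Fin m → Bool) → ℤ} {D : ℤ} (hD : D ≠ 0) (hDt : D.natAbs < 3 ^ t₀)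
    (hc : ∀ s ∈ 𝒮, ∀ i, (if s i then (1 : ℚ) else 0) = ∑ l ∈ B, if s l then c i l else 0)
    (he : ∀ l ∈ B, ∀ i ∈ B, (∑ s ∈ 𝒮, if s i then e l s else 0) = if i = l then D else 0)
    {ρ η θ α : ℝ} (hρ : ∀ i, r₀ ≤ #{l ∈ B | c i l ≠ 0} → ∀ s, conc t B (c i) s ≤ ρ)
    (hρη : 2 * ρ ≤ η / 2) (hη : 0 < η) (hθ0 : 0 < θ) (hθ1 : θ ≤ 1) (hθη : θ ^ k₀ ≤ η / 2)
    (hm : k₀ * (r₀ + 1) ≤ m)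
    {h : (Fin n → Bool) → ℝ} (hh0 : ∀ x, 0 ≤ h x)
    (hhw : ∀ x, h x ≤ rowWeight t x) (hhα : ∀ x, h x ≤ α)
    (hα : (3 : ℝ) ^ j * α ≤ θ ^ n) :
    ∑ X : Fin m → Fin n → Bool with columnSet X = 𝒮, (∏ i, h (X i)) *
        ∑ u : Fin n → ZMod (3 ^ j), ∏ i, testFun (3 ^ j) (3 ^ t₀) (subsetSum (X i) u) ≤
      ((3 : ℝ) ^ j) ^ n * (2 * 3 ^ t₀) ^ m * (η / 2) ^ n := by
  classical
  obtain ⟨c', hc'⟩ := exists_mul_eq_three_pow hD hDt j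
  have hα0 : 0 ≤ α := (hh0 fun _ => false).trans (hhα _)
  have hlift : ∀ X : Fin m → Fin n → Bool, columnSet X = 𝒮 →
      ∃ E : Fin m → Fin n → ZMod (3 ^ j), ∀ l i, subsetSum (X i) (E l) =
        ((∑ s ∈ 𝒮, if s i then e l s else 0 : ℤ) : ZMod (3 ^ j)) := by
    intro X hX
    choose E hE using fun l => exists_lift_columnSet X (e l)
    refine ⟨fun l a => (E l a : ZMod (3 ^ j)), fun l i => ?_⟩
    rw [← hX, ← hE l i]
    exact subsetSum_map (Int.castAddHom (ZMod (3 ^ j))) (X i) (E l)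
  by_cases hcase : ∃ l ∈ B, ∀ i, i ∉ B → c i l = 0
  · obtain ⟨l, hl, hli⟩ := hcase
    rw [sum_eq_zero]
    · positivity
    intro X hX
    obtain ⟨E, hE⟩ := hlift X (mem_filter.1 hX).2
    rw [sum_prod_testFun_eq_zero (D := (D : ZMod (3 ^ j))) (c := c') (by exact_mod_cast hc') X
      (E l) l, mul_zero]
    · rw [hE, he l hl l hl, if_pos rfl]
    · intro i hi
      rw [hE]
      by_cases hiB : i ∈ B
      · rw [he l hl i hiB, if_neg hi, Int.cast_zero]
      · rw [sum_dual_eq_zero (fun s hs => hc s hs i) (he l hl) (hli i hiB), Int.cast_zero]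
  · push Not at hcase
    have hS : ∀ X ∈ (univ.filter fun X : Fin m → Fin n → Bool => columnSet X = 𝒮),
        ∑ u : Fin n → ZMod (3 ^ j), ∏ i, testFun (3 ^ j) (3 ^ t₀) (subsetSum (X i) u) ≤
          ((3 : ℝ) ^ j) ^ #Bᶜ * (((3 : ℝ) ^ j) ^ n * (2 * 3 ^ t₀) ^ m) := by
      intro X hX
      obtain ⟨E, hE⟩ := hlift X (mem_filter.1 hX).2
      have := sum_prod_testFun_le (Q := 3 ^ j) (T := 3 ^ t₀) (by positivity) X B D c'
        (by exact_mod_cast hc') E (fun l hl i hi => by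
          rw [hE, he l hl i hi]; split_ifs <;> simp)
      push_cast [Fintype.card_fin] at this
      refine this.trans ?_
      have h3 : (1 : ℝ) ≤ 2 * 3 ^ t₀ := by
        have : (1 : ℝ) ≤ 3 ^ t₀ := one_le_pow₀ (by norm_num)
        linarith
      have h4 : #B ≤ m := by simpa using card_le_univ B
      gcongr
    have hw : ∀ X : Fin m → Fin n → Bool, 0 ≤ ∏ i, h (X i) := fun X =>
      prod_nonneg fun i _ => hh0 _
    refine (sum_le_sum fun X hX => mul_le_mul_of_nonneg_left (hS X hX) (hw X)).trans ?_
    rw [← sum_mul]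
    refine (mul_le_mul_of_nonneg_right (sum_prod_le_of_columnSet h0 h1 𝒮 B hh0 hhw hhα)
      (by positivity)).trans ?_
    set W := ∑ s ∈ 𝒮, ∏ l ∈ B, if s l then t else 1 - t
    have hW0 : 0 ≤ W := sum_nonneg fun s _ => prod_nonneg fun l _ => by split_ifs <;> linarith
    have hkey : ((3 : ℝ) ^ j * α) ^ #Bᶜ * W ^ n ≤ (η / 2) ^ n := by
      have hθn : (3 : ℝ) ^ j * α ≤ 1 := hα.trans (pow_le_one₀ hθ0.le hθ1)
      have hjα : 0 ≤ (3 : ℝ) ^ j * α := by positivity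
      by_cases hk : k₀ ≤ #Bᶜ
      · have hW1 : W ≤ 1 := sum_prod_le_one h0 h1 hc
        calc _ ≤ ((3 : ℝ) ^ j * α) ^ k₀ * 1 := mul_le_mul
              (pow_le_pow_of_le_one hjα hθn hk) (pow_le_one₀ hW0 hW1) (by positivity)
              (by positivity)
          _ ≤ (θ ^ n) ^ k₀ := by rw [mul_one]; exact pow_le_pow_left₀ hjα hα _
          _ = (θ ^ k₀) ^ n := by rw [← pow_mul, ← pow_mul, mul_comm]
          _ ≤ _ := pow_le_pow_left₀ (by positivity) hθη _
      · obtain ⟨i, hi⟩ : ∃ i, r₀ ≤ #{l ∈ B | c i l ≠ 0} := by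
          by_contra! hcon
          have hsub : B ⊆ Bᶜ.biUnion fun i => {l ∈ B | c i l ≠ 0} := by
            intro l hl
            obtain ⟨i, hi, hil⟩ := hcase l hl
            exact mem_biUnion.2 ⟨i, mem_compl.2 hi, mem_filter.2 ⟨hl, hil⟩⟩
          have h5 := (card_le_card hsub).trans (card_biUnion_le_card_mul _ _ r₀
            fun i _ => (hcon i).le)
          have h6 : #B + #Bᶜ = m := by simp [card_compl, Nat.add_sub_cancel' (card_finset_fin_le B)]
          have h7 : m ≤ #Bᶜ * (r₀ + 1) := by
            rw [mul_add, mul_one]; omega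
          have h8 : #Bᶜ < k₀ := by omega
          have h9 : #Bᶜ * (r₀ + 1) < k₀ * (r₀ + 1) := Nat.mul_lt_mul_of_pos_right h8 (Nat.succ_pos _)
          omega
        have hWη : W ≤ η / 2 := by
          have := sum_prod_le_conc h0 h1 hc i
          linarith [hρ i hi 0, hρ i hi 1]
        calc _ ≤ 1 * (η / 2) ^ n := mul_le_mul (pow_le_one₀ hjα hθn)
              (pow_le_pow_left₀ hW0 hWη _) (by positivity) zero_le_one
          _ = _ := one_mul _
    calc _ = (((3 : ℝ) ^ j * α) ^ #Bᶜ * W ^ n) * (((3 : ℝ) ^ j) ^ n * (2 * 3 ^ t₀) ^ m) := by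
          rw [mul_pow]; ring
      _ ≤ (η / 2) ^ n * (((3 : ℝ) ^ j) ^ n * (2 * 3 ^ t₀) ^ m) :=
          mul_le_mul_of_nonneg_right hkey (by positivity)
      _ = _ := by ring

end

section

/-! ### Counting concentrated vectors -/

variable {t : ℝ}

/-- Total `h`-mass of the `0`/`1` vectors orthogonal to `u`. -/
noncomputable def zeroMass {n : ℕ} {G : Type*} [AddCommGroup G] [DecidableEq G]
    (h : (Fin n → Bool) → ℝ) (u : Fin n → G) : ℝ :=
  ∑ x, h x * if subsetSum x u = 0 then 1 else 0

lemma zeroMass_le_conc {n : ℕ} {G : Type*} [AddCommGroup G] [DecidableEq G]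
    {h : (Fin n → Bool) → ℝ} (hhw : ∀ x, h x ≤ rowWeight t x) (u : Fin n → G) :
    zeroMass h u ≤ conc t univ u 0 := by
  rw [← sum_rowWeight_mul_ite]
  exact sum_le_sum fun x _ => mul_le_mul_of_nonneg_right (hhw x) (by split_ifs <;> simp)

lemma unitCount_le_castHom {n Q T : ℕ} (hd : T ∣ Q) (u : Fin n → ZMod Q) :
    unitCount u ≤ unitCount fun i => ZMod.castHom hd (ZMod T) (u i) :=
  card_le_card fun i hi => by
    simp only [mem_filter, mem_univ, true_and] at hi ⊢
    exact hi.map _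

lemma sum_mul_testFun_pow {n m : ℕ} {Q : ℕ} [NeZero Q] (T : ℕ) (h : (Fin n → Bool) → ℝ) :
    ∑ u : Fin n → ZMod Q, (∑ x, h x * testFun Q T (subsetSum x u)) ^ m =
      ∑ X : Fin m → Fin n → Bool, (∏ i, h (X i)) *
        ∑ u : Fin n → ZMod Q, ∏ i, testFun Q T (subsetSum (X i) u) := by
  simp_rw [Fintype.sum_pow, mul_sum]
  rw [sum_comm]
  exact sum_congr rfl fun X _ => sum_congr rfl fun u _ => prod_mul_distrib

lemma zeroMass_sub_le {n j t₀ : ℕ} (hj : t₀ ≤ j) {h : (Fin n → Bool) → ℝ} (hh0 : ∀ x, 0 ≤ h x)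
    (hhw : ∀ x, h x ≤ rowWeight t x) (u : Fin n → ZMod (3 ^ j))
    (hu : conc t univ (fun i => ZMod.castHom (pow_dvd_pow 3 hj) (ZMod (3 ^ t₀)) (u i)) 0 ≤
      2 / 3 ^ t₀) :
    (3 : ℝ) ^ j * zeroMass h u - 2 ≤
      ∑ x, h x * testFun (3 ^ j) (3 ^ t₀) (subsetSum x u) := by
  classical
  set f := ZMod.castHom (pow_dvd_pow 3 hj) (ZMod (3 ^ t₀))
  have hz := fun z : ZMod (3 ^ j) => show (3 : ℝ) ^ j * (if z = 0 then 1 else 0) -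
      3 ^ t₀ * (if f z = 0 then 1 else 0) ≤ testFun (3 ^ j) (3 ^ t₀) z by
    unfold testFun
    rw [sum_sub_distrib, sum_const, card_univ, ZMod.card, nsmul_eq_mul]
    push_cast
    refine sub_le_sub_left ?_ _
    split_ifs with hf
    · rw [sum_boole, mul_one]
      have := card_mul_eq_le (Q := 3 ^ j) (T := 3 ^ t₀) (D := ((3 ^ t₀ : ℕ) : ZMod (3 ^ j)))
        (c := 1) (by positivity) (mul_one _).symm z
      have h2 : #{b : ZMod (3 ^ j) | z = 3 ^ t₀ * b} ≤ 3 ^ t₀ := by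
        refine le_trans (card_le_card fun b hb => ?_) this
        simp only [mem_filter, mem_univ, true_and] at hb ⊢
        rw [hb, mul_comm]; push_cast; rfl
      exact_mod_cast h2
    · rw [mul_zero]
      refine (sum_eq_zero fun b _ => if_neg fun hb => hf ?_).le
      rw [hb, map_mul]
      have : f (3 ^ t₀) = 0 := by
        have h3 : ((3 ^ t₀ : ℕ) : ZMod (3 ^ t₀)) = 0 := ZMod.natCast_self _
        rw [map_pow, map_ofNat]
        exact_mod_cast h3
      rw [this, zero_mul]
  have h4 : ∑ x, h x * (if f (subsetSum x u) = 0 then 1 else 0) ≤ 2 / 3 ^ t₀ := by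
    refine le_trans ?_ ((zeroMass_le_conc hhw _).trans hu)
    refine le_of_eq (sum_congr rfl fun x _ => ?_)
    have := subsetSum_map f.toAddMonoidHom x u
    simp only [RingHom.toAddMonoidHom_eq_coe, AddMonoidHom.coe_coe] at this
    rw [this]
  have h5 : (3 : ℝ) ^ t₀ * ∑ x, h x * (if f (subsetSum x u) = 0 then 1 else 0) ≤ 2 := by
    rw [le_div_iff₀ (by positivity)] at h4
    linarith
  calc _ ≤ (3 : ℝ) ^ j * zeroMass h u -
        3 ^ t₀ * ∑ x, h x * (if f (subsetSum x u) = 0 then 1 else 0) := by linarith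
    _ = ∑ x, h x * ((3 : ℝ) ^ j * (if subsetSum x u = 0 then 1 else 0) -
          3 ^ t₀ * (if f (subsetSum x u) = 0 then 1 else 0)) := by
        unfold zeroMass
        rw [mul_sum, mul_sum, ← sum_sub_distrib]
        exact sum_congr rfl fun x _ => by ring
    _ ≤ _ := sum_le_sum fun x _ => mul_le_mul_of_nonneg_left (hz _) (hh0 x)

open scoped Classical in
/-- Few vectors modulo `3 ^ j` with linearly many unit coordinates have a zero sum atom much
larger than `3 ^ (-j)`. -/
lemma eventually_card_zeroMass_gt_le (h0 : 0 < t) (h1 : t < 1 / 2) {η θ c₀ : ℝ} (hη : 0 < η)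
    (hθ0 : 0 < θ) (hθ1 : θ < 1) (hc₀ : 0 < c₀) :
    ∀ᶠ n : ℕ in atTop, ∀ (h : (Fin n → Bool) → ℝ) (α : ℝ) (j : ℕ), (∀ x, 0 ≤ h x) →
      (∀ x, h x ≤ rowWeight t x) → (∀ x, h x ≤ α) → (3 : ℝ) ^ j * α ≤ θ ^ n →
      (#{u : Fin n → ZMod (3 ^ j) | c₀ * n ≤ unitCount u ∧ 3 < (3 : ℝ) ^ j * zeroMass h u} : ℝ) ≤
        ((3 : ℝ) ^ j) ^ n * η ^ n := by
  have ht : t ≤ 1 := by linarith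
  obtain ⟨k₀, hk₀⟩ := exists_pow_lt_of_lt_one (half_pos hη) hθ1
  obtain ⟨r₀, hr₀⟩ := exists_conc_rat_le h0 h1 (show (0 : ℝ) < η / 4 by positivity)
  obtain ⟨m, hm, hme⟩ : ∃ m, k₀ * (r₀ + 1) ≤ m ∧ Even m :=
    ⟨2 * (k₀ * (r₀ + 1)), by omega, even_two_mul _⟩
  choose B c e D hD hc he using fun 𝒮 : Finset (Fin m → Bool) => exists_rowBasis 𝒮
  obtain ⟨t₀, ht₀⟩ : ∃ t₀ : ℕ, ∀ 𝒮, (D 𝒮).natAbs < 3 ^ t₀ := by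
    refine ⟨univ.sup fun 𝒮 => (D 𝒮).natAbs, fun 𝒮 => ?_⟩
    exact (Nat.lt_pow_self (by norm_num)).trans_le (Nat.pow_le_pow_right (by norm_num)
      (le_sup (f := fun 𝒮 => (D 𝒮).natAbs) (mem_univ 𝒮)))
  have hev : ∀ᶠ n : ℕ in atTop, ∀ j ≤ t₀, ∀ u : Fin n → ZMod (3 ^ j),
      c₀ * n ≤ unitCount u → ∀ s, conc t univ u s ≤ 2 / (3 ^ j : ℕ) :=
    (eventually_all_finite (Set.finite_Iic t₀)).2 fun j _ =>
      eventually_conc_zmod_le h0 h1 (3 ^ j) hc₀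
  obtain ⟨n₁, hn₁⟩ := pow_unbounded_of_one_lt
    ((Fintype.card (Finset (Fin m → Bool)) : ℝ) * (2 * 3 ^ t₀) ^ m) (one_lt_two)
  filter_upwards [hev, eventually_ge_atTop n₁] with n hn hnn h α j hh0 hhw hhα hα
  by_cases hj : j ≤ t₀
  · rw [filter_eq_empty_iff.2, card_empty, Nat.cast_zero]
    · positivity
    rintro u - ⟨hu, hlt⟩
    have h2 := (zeroMass_le_conc hhw u).trans (hn j hj u hu 0)
    push_cast at h2
    rw [le_div_iff₀ (by positivity)] at h2
    linarith
  · push Not at hj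
    have hD1 : ∀ u : Fin n → ZMod (3 ^ j), c₀ * n ≤ unitCount u → 3 < (3 : ℝ) ^ j * zeroMass h u →
        1 ≤ (∑ x, h x * testFun (3 ^ j) (3 ^ t₀) (subsetSum x u)) ^ m := by
      intro u hu hlt
      refine one_le_pow₀ (le_trans (by linarith) (zeroMass_sub_le hj.le hh0 hhw u ?_))
      have := hn t₀ le_rfl (fun i => ZMod.castHom (pow_dvd_pow 3 hj.le) (ZMod (3 ^ t₀)) (u i))
        (hu.trans (by exact_mod_cast unitCount_le_castHom (pow_dvd_pow 3 hj.le) u)) 0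
      push_cast at this
      exact this
    have hcard : (#{u : Fin n → ZMod (3 ^ j) | c₀ * n ≤ unitCount u ∧
        3 < (3 : ℝ) ^ j * zeroMass h u} : ℝ) ≤
        ∑ u : Fin n → ZMod (3 ^ j),
          (∑ x, h x * testFun (3 ^ j) (3 ^ t₀) (subsetSum x u)) ^ m := by
      rw [card_eq_sum_ones, Nat.cast_sum]
      refine (sum_le_sum fun u hu => ?_).trans (sum_le_sum_of_subset_of_nonneg (filter_subset _ _)
        fun u _ _ => hme.pow_nonneg _)
      rw [Nat.cast_one]
      exact hD1 u (mem_filter.1 hu).2.1 (mem_filter.1 hu).2.2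
    refine hcard.trans ?_
    rw [sum_mul_testFun_pow, ← sum_fiberwise (g := columnSet)]
    have hterm := fun 𝒮 : Finset (Fin m → Bool) => sum_prod_mul_testFun_le (n := n) (j := j)
      (r₀ := r₀) h0.le ht 𝒮 (hD 𝒮) (ht₀ 𝒮) (hc 𝒮) (he 𝒮) (ρ := η / 4)
      (fun i hi => hr₀ m (B 𝒮) (c 𝒮 i) hi) (by linarith) hη hθ0 hθ1.le hk₀.le hm hh0 hhw hhα hα
    refine (sum_le_sum fun 𝒮 _ => hterm 𝒮).trans ?_
    rw [sum_const, card_univ, nsmul_eq_mul]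
    have h2n : (Fintype.card (Finset (Fin m → Bool)) : ℝ) * (2 * 3 ^ t₀) ^ m ≤ 2 ^ n :=
      hn₁.le.trans (pow_le_pow_right₀ one_le_two hnn)
    calc _ = (Fintype.card (Finset (Fin m → Bool)) : ℝ) * (2 * 3 ^ t₀) ^ m *
          (((3 : ℝ) ^ j) ^ n * (η / 2) ^ n) := by ring
      _ ≤ 2 ^ n * (((3 : ℝ) ^ j) ^ n * (η / 2) ^ n) :=
          mul_le_mul_of_nonneg_right h2n (by positivity)
      _ = _ := by
          rw [div_pow]; field_simp

end

section

/-! ### Probabilities of matrix events -/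

variable {t : ℝ} {n : ℕ}

/-- Probability of an event for a random `n × n` matrix with independent Bernoulli(`t`)
entries. -/
noncomputable def prob (t : ℝ) (E : (Fin n → Fin n → Bool) → Prop) : ℝ :=
  open scoped Classical in
  ∑ A : Fin n → Fin n → Bool, (∏ i, rowWeight t (A i)) * if E A then 1 else 0

/-- Probability of an event for a random vector with independent Bernoulli(`t`) entries. -/
noncomputable def rowProb (t : ℝ) (E : (Fin n → Bool) → Prop) : ℝ :=
  open scoped Classical in ∑ x : Fin n → Bool, rowWeight t x * if E x then 1 else 0

lemma prod_rowWeight_nonneg (h0 : 0 ≤ t) (h1 : t ≤ 1) (A : Fin n → Fin n → Bool) :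
    0 ≤ ∏ i, rowWeight t (A i) :=
  prod_nonneg fun _ _ => rowWeight_nonneg h0 h1 _

lemma prob_nonneg (h0 : 0 ≤ t) (h1 : t ≤ 1) (E : (Fin n → Fin n → Bool) → Prop) :
    0 ≤ prob t E :=
  sum_nonneg fun A _ => mul_nonneg (prod_rowWeight_nonneg h0 h1 A) (by split_ifs <;> simp)

lemma rowProb_nonneg (h0 : 0 ≤ t) (h1 : t ≤ 1) (E : (Fin n → Bool) → Prop) :
    0 ≤ rowProb t E :=
  sum_nonneg fun A _ => mul_nonneg (rowWeight_nonneg h0 h1 A) (by split_ifs <;> simp)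

lemma prob_mono (h0 : 0 ≤ t) (h1 : t ≤ 1) {E E' : (Fin n → Fin n → Bool) → Prop}
    (h : ∀ A, E A → E' A) : prob t E ≤ prob t E' := by
  classical
  refine sum_le_sum fun A _ => mul_le_mul_of_nonneg_left ?_ (prod_rowWeight_nonneg h0 h1 A)
  by_cases hE : E A
  · simp [hE, h A hE]
  · simp only [hE, if_false]; split_ifs <;> simp

lemma prob_or_le (h0 : 0 ≤ t) (h1 : t ≤ 1) (E E' : (Fin n → Fin n → Bool) → Prop) :
    prob t (fun A => E A ∨ E' A) ≤ prob t E + prob t E' := by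
  classical
  unfold prob
  rw [← sum_add_distrib]
  refine sum_le_sum fun A _ => ?_
  rw [← mul_add]
  refine mul_le_mul_of_nonneg_left ?_ (prod_rowWeight_nonneg h0 h1 A)
  by_cases hE : E A <;> by_cases hE' : E' A <;> simp [hE, hE']

lemma prob_exists_le (h0 : 0 ≤ t) (h1 : t ≤ 1) {κ : Type*} (S : Finset κ)
    (E : κ → (Fin n → Fin n → Bool) → Prop) :
    prob t (fun A => ∃ k ∈ S, E k A) ≤ ∑ k ∈ S, prob t (E k) := by
  classical
  unfold prob
  rw [sum_comm]
  refine sum_le_sum fun A _ => ?_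
  rw [← mul_sum]
  refine mul_le_mul_of_nonneg_left ?_ (prod_rowWeight_nonneg h0 h1 A)
  split_ifs with h
  · obtain ⟨k, hk, hE⟩ := h
    refine le_trans ?_ (single_le_sum (f := fun k => if E k A then (1 : ℝ) else 0)
      (fun _ _ => by split_ifs <;> simp) hk)
    simp [hE]
  · exact sum_nonneg fun _ _ => by split_ifs <;> simp

lemma sum_prod_rowWeight (t : ℝ) (n : ℕ) :
    ∑ A : Fin n → Fin n → Bool, ∏ i, rowWeight t (A i) = 1 := by
  have := Finset.prod_univ_sum (fun _ : Fin n => (univ : Finset (Fin n → Bool)))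
    (fun _ x => rowWeight t x)
  rw [Fintype.piFinset_univ] at this
  rw [← this]
  simp [sum_rowWeight]

lemma prob_add_prob_not (t : ℝ) (E : (Fin n → Fin n → Bool) → Prop) :
    prob t E + prob t (fun A => ¬ E A) = 1 := by
  classical
  unfold prob
  rw [← sum_add_distrib]
  refine (sum_congr rfl fun A _ => ?_).trans (sum_prod_rowWeight t n)
  by_cases h : E A <;> simp [h]

lemma prob_forall_mem (t : ℝ) (S : Finset (Fin n)) (E : (Fin n → Bool) → Prop) :
    prob t (fun A => ∀ i ∈ S, E (A i)) = rowProb t E ^ #S := by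
  classical
  have := Finset.prod_univ_sum (fun _ : Fin n => (univ : Finset (Fin n → Bool)))
    (fun i x => rowWeight t x * if i ∈ S → E x then 1 else 0)
  rw [Fintype.piFinset_univ] at this
  have h2 : prob t (fun A => ∀ i ∈ S, E (A i)) =
      ∑ A : Fin n → Fin n → Bool, ∏ i, rowWeight t (A i) * if i ∈ S → E (A i) then 1 else 0 := by
    refine sum_congr rfl fun A _ => ?_
    rw [prod_mul_distrib, prod_ite_zero]
    simp
  rw [h2, ← this, ← prod_const, ← prod_subset (subset_univ S)]
  · refine prod_congr rfl fun i hi => ?_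
    unfold rowProb
    simp [hi]
  · intro i _ hi
    simp [hi, sum_rowWeight]

lemma prob_forall (t : ℝ) (E : (Fin n → Bool) → Prop) :
    prob t (fun A : Fin n → Fin n → Bool => ∀ i, E (A i)) = rowProb t E ^ n := by
  simpa using prob_forall_mem t (univ : Finset (Fin n)) E

lemma prob_swap (t : ℝ) (E : (Fin n → Fin n → Bool) → Prop) :
    prob t (fun A => E (Function.swap A)) = prob t E := by
  classical
  refine Fintype.sum_equiv (Equiv.piComm fun _ _ => Bool) _ _ fun A => ?_
  unfold rowWeight
  rw [Finset.prod_comm]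
  rfl

/-- Conditioning on all rows except row `i`. -/
lemma prob_le_of_update (h0 : 0 ≤ t) (h1 : t ≤ 1) {E : (Fin n → Fin n → Bool) → Prop} (i : Fin n)
    {β : ℝ} (h : ∀ A, rowProb t (fun x => E (Function.update A i x)) ≤ β) : prob t E ≤ β := by
  classical
  have hprod : ∀ (A : Fin n → Fin n → Bool) x, (∏ l, rowWeight t (A l)) * rowWeight t x =
      (∏ l, rowWeight t (Function.update A i x l)) * rowWeight t (A i) := by
    intro A x
    rw [← mul_prod_erase univ (fun l => rowWeight t (A l)) (mem_univ i),
      ← mul_prod_erase univ (fun l => rowWeight t (Function.update A i x l)) (mem_univ i),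
      Function.update_self]
    have : ∏ l ∈ univ.erase i, rowWeight t (Function.update A i x l) =
        ∏ l ∈ univ.erase i, rowWeight t (A l) :=
      prod_congr rfl fun l hl => by rw [Function.update_of_ne (ne_of_mem_erase hl)]
    rw [this]; ring
  have hE : prob t E = ∑ A : Fin n → Fin n → Bool, (∏ l, rowWeight t (A l)) *
      rowProb t (fun x => E (Function.update A i x)) := by
    have hleft : prob t E = ∑ A : Fin n → Fin n → Bool, ∑ x : Fin n → Bool,
        ((∏ l, rowWeight t (A l)) * rowWeight t x) * if E A then 1 else 0 := by
      refine sum_congr rfl fun A _ => ?_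
      rw [← sum_mul, ← mul_sum, sum_rowWeight, mul_one]
    rw [hleft]
    unfold rowProb
    simp_rw [mul_sum]
    rw [← Fintype.sum_prod_type', ← Fintype.sum_prod_type' (f := fun A x => (∏ l, rowWeight t (A l)) *
      (rowWeight t x * if E (Function.update A i x) then 1 else 0))]
    refine sum_bij' (fun p _ => (Function.update p.1 i p.2, p.1 i))
      (fun p _ => (Function.update p.1 i p.2, p.1 i)) (by simp) (by simp) ?_ ?_ ?_
    · rintro ⟨A, x⟩ _; simp
    · rintro ⟨A, x⟩ _; simp
    · rintro ⟨A, x⟩ _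
      simp only [Function.update_idem, Function.update_eq_self]
      rw [hprod A x, mul_assoc]
  rw [hE]
  calc _ ≤ ∑ A : Fin n → Fin n → Bool, (∏ l, rowWeight t (A l)) * β :=
        sum_le_sum fun A _ => mul_le_mul_of_nonneg_left (h A) (prod_rowWeight_nonneg h0 h1 A)
    _ = β := by rw [← sum_mul, sum_prod_rowWeight, one_mul]

lemma rowProb_eq_conc {G : Type*} [AddCommGroup G] (u : Fin n → G) (s : G) :
    rowProb t (fun x => subsetSum x u = s) = conc t univ u s := by
  classical
  rw [← sum_rowWeight_mul_ite]
  unfold rowProb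
  refine sum_congr rfl fun x _ => by congr

/-! ### Atoms modulo `3` -/

lemma conc_empty {ι G : Type*} [AddCommGroup G] [DecidableEq G] (u : ι → G) (s : G) :
    conc t ∅ u s = if 0 = s then 1 else 0 := by
  simp [conc]

lemma conc_le_of_ne_zero (h0 : 0 < t) (h1 : t < 1 / 2) {u : Fin n → ZMod 3} {j : Fin n}
    (hj : u j ≠ 0) (s : ZMod 3) : conc t univ u s ≤ 1 - t := by
  refine conc_mono_bound (S := {j}) h0.le (by linarith) (subset_univ _) (fun s => ?_) s
  rw [← insert_empty_eq, conc_insert (notMem_empty j)]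
  simp only [conc_empty]
  have : s - u j = 0 → s ≠ 0 := fun h h' => hj (by rw [h', zero_sub, neg_eq_zero] at h; exact h)
  split_ifs with a b <;> first | linarith | exact absurd a.symm (this b.symm)

lemma conc_le_of_eq_neg (h0 : 0 < t) (h1 : t < 1 / 2) {u : Fin n → ZMod 3} {j k : Fin n}
    (hjk : j ≠ k) (hj : u j = 1) (hk : u k = 2) (s : ZMod 3) :
    conc t univ u s ≤ t ^ 2 + (1 - t) ^ 2 := by
  refine conc_mono_bound (S := {j, k}) h0.le (by linarith) (subset_univ _) (fun s => ?_) s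
  rw [conc_insert (by simpa using hjk), ← insert_empty_eq, conc_insert (notMem_empty k),
    conc_insert (notMem_empty k), hj, hk]
  simp only [conc_empty]
  have hs : s = 0 ∨ s = 1 ∨ s = 2 := by revert s; decide
  rcases hs with rfl | rfl | rfl <;> simp +decide <;> nlinarith

lemma exists_conc_lt_of_three (h0 : 0 < t) (h1 : t < 1 / 2) :
    ∃ ρ : ℝ, 0 < ρ ∧ ρ < t ^ 2 + (1 - t) ^ 2 ∧ ∀ (n : ℕ) (u : Fin n → ZMod 3),
      3 ≤ #{i | u i ≠ 0} → ∀ s, conc t univ u s ≤ ρ := by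
  let f : ZMod 3 → ZMod 3 → ZMod 3 → ZMod 3 → ℝ := fun a b c s =>
    (1 - t) * ((1 - t) * ((1 - t) * (if 0 = s then 1 else 0) + t * (if 0 = s - c then 1 else 0)) +
      t * ((1 - t) * (if 0 = s - b then 1 else 0) + t * (if 0 = s - b - c then 1 else 0))) +
    t * ((1 - t) * ((1 - t) * (if 0 = s - a then 1 else 0) + t * (if 0 = s - a - c then 1 else 0)) +
      t * ((1 - t) * (if 0 = s - a - b then 1 else 0) +
        t * (if 0 = s - a - b - c then 1 else 0)))
  have hf : ∀ a b c s : ZMod 3, a ≠ 0 → b ≠ 0 → c ≠ 0 → f a b c s < t ^ 2 + (1 - t) ^ 2 := by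
    have h12 : ∀ a : ZMod 3, a ≠ 0 → a = 1 ∨ a = 2 := by decide
    have h012 : ∀ s : ZMod 3, s = 0 ∨ s = 1 ∨ s = 2 := by decide
    intro a b c s ha hb hc
    simp only [f]
    rcases h12 a ha with rfl | rfl <;> rcases h12 b hb with rfl | rfl <;>
      rcases h12 c hc with rfl | rfl <;> rcases h012 s with rfl | rfl | rfl <;>
      simp +decide <;>
      nlinarith [mul_pos h0 (sub_pos.2 h1), mul_pos (mul_pos h0 h0) (sub_pos.2 h1),
        mul_nonneg h0.le (sq_nonneg (t - 2 / 5))]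
  obtain ⟨ρ, hρ⟩ : ∃ ρ : ℝ, ρ < t ^ 2 + (1 - t) ^ 2 ∧ ∀ a b c s : ZMod 3, a ≠ 0 → b ≠ 0 → c ≠ 0 →
      f a b c s ≤ ρ := by
    let P : Finset (ZMod 3 × ZMod 3 × ZMod 3 × ZMod 3) :=
      univ.filter fun p => p.1 ≠ 0 ∧ p.2.1 ≠ 0 ∧ p.2.2.1 ≠ 0
    have hP : P.Nonempty := ⟨(1, 1, 1, 0), by decide⟩
    obtain ⟨p, hp, hmax⟩ := P.exists_max_image (fun p => f p.1 p.2.1 p.2.2.1 p.2.2.2) hP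
    have hp' := (mem_filter.1 hp).2
    exact ⟨_, hf _ _ _ p.2.2.2 hp'.1 hp'.2.1 hp'.2.2, fun a b c s ha hb hc =>
      hmax (a, b, c, s) (mem_filter.2 ⟨mem_univ _, ha, hb, hc⟩)⟩
  have hr : 0 < t ^ 2 + (1 - t) ^ 2 := by positivity
  refine ⟨max ρ ((t ^ 2 + (1 - t) ^ 2) / 2), lt_max_of_lt_right (by linarith),
    max_lt hρ.1 (by linarith), fun n u hu s => le_max_of_le_left ?_⟩
  obtain ⟨S, hS, hS3⟩ := exists_subset_card_eq hu
  obtain ⟨a, b, c, hab, hac, hbc, rfl⟩ := card_eq_three.1 hS3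
  refine conc_mono_bound (S := {a, b, c}) h0.le (by linarith) (subset_univ _) (fun s => ?_) s
  have ha := (mem_filter.1 (hS (by simp : a ∈ ({a, b, c} : Finset (Fin n))))).2
  have hb := (mem_filter.1 (hS (by simp : b ∈ ({a, b, c} : Finset (Fin n))))).2
  have hc := (mem_filter.1 (hS (by simp : c ∈ ({a, b, c} : Finset (Fin n))))).2
  refine le_of_eq_of_le ?_ (hρ.2 (u a) (u b) (u c) s ha hb hc)
  rw [conc_insert (by simp [hab, hac]), conc_insert (by simp [hbc]),
    conc_insert (by simp [hbc]), ← insert_empty_eq]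
  simp only [conc_insert (notMem_empty _), conc_empty, f]

end

section

/-! ### Sparse kernel vectors modulo `3` -/

variable {t : ℝ} {n : ℕ}

lemma unitCount_three (u : Fin n → ZMod 3) : unitCount u = #{i | u i ≠ 0} := by
  have : Fact (Nat.Prime 3) := ⟨Nat.prime_three⟩
  unfold unitCount
  simp only [isUnit_iff_ne_zero]

lemma subsetSum_eq_sum {G : Type*} [AddCommGroup G] {S : Finset (Fin n)} {u : Fin n → G}
    (hu : ∀ i, i ∉ S → u i = 0) (x : Fin n → Bool) :
    subsetSum x u = ∑ i ∈ S, if x i then u i else 0 :=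
  (sum_subset (subset_univ S) fun i _ hi => by simp [hu i hi]).symm

/-- A nonzero vector modulo `3` with fewer than `n / L` nonzero entries is orthogonal to all
rows. -/
def SparseKernel (L : ℕ) (A : Fin n → Fin n → Bool) : Prop :=
  ∃ u : Fin n → ZMod 3, u ≠ 0 ∧ L * unitCount u < n ∧ ∀ i, subsetSum (A i) u = 0

lemma rowProb_eq_false_le (h0 : 0 < t) (h1 : t < 1 / 2) (j : Fin n) :
    rowProb t (fun x => x j = false) ≤ 1 - t := by
  have h : (fun x : Fin n → Bool => x j = false) =
      fun x => subsetSum x (Pi.single j (1 : ZMod 3)) = 0 := by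
    ext x
    rw [subsetSum_eq_sum (S := {j}) fun i hi => Pi.single_eq_of_ne (by simpa using hi) _]
    cases h : x j <;> simp [h]
  rw [h, rowProb_eq_conc]
  exact conc_le_of_ne_zero (j := j) h0 h1 (by simp) 0

lemma rowProb_eq_le (h0 : 0 < t) (h1 : t < 1 / 2) {j k : Fin n} (hjk : j ≠ k) :
    rowProb t (fun x => x j = x k) ≤ t ^ 2 + (1 - t) ^ 2 := by
  let u : Fin n → ZMod 3 := fun i => if i = j then 1 else if i = k then 2 else 0
  have hj : u j = 1 := by simp [u]
  have hk : u k = 2 := by simp [u, hjk.symm]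
  have h : (fun x : Fin n → Bool => x j = x k) = fun x => subsetSum x u = 0 := by
    ext x
    rw [subsetSum_eq_sum (S := {j, k}) fun i hi => by
      simp only [mem_insert, mem_singleton, not_or] at hi; simp [u, hi.1, hi.2], sum_pair hjk,
      hj, hk]
    cases x j <;> cases x k <;> decide
  rw [h, rowProb_eq_conc]
  exact conc_le_of_eq_neg h0 h1 hjk hj hk 0

lemma SparseKernel.cases {L : ℕ} {A : Fin n → Fin n → Bool} (hA : SparseKernel L A) :
    (∃ j ∈ (univ : Finset (Fin n)), ∀ i, A i j = false) ∨
      (∃ p ∈ (univ.filter fun p : Fin n × Fin n => p.1 < p.2), ∀ i, A i p.1 = A i p.2) ∨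
      ∃ u ∈ (univ.filter fun u : Fin n → ZMod 3 => 3 ≤ unitCount u ∧ L * unitCount u < n),
        ∀ i, subsetSum (A i) u = 0 := by
  obtain ⟨u, hu0, huL, hu⟩ := hA
  by_cases h3 : 3 ≤ unitCount u
  · exact Or.inr (Or.inr ⟨u, by simp [h3, huL], hu⟩)
  push Not at h3
  rw [unitCount_three] at h3
  set S : Finset (Fin n) := univ.filter fun i => u i ≠ 0 with hS
  have hsupp : ∀ i, i ∉ S → u i = 0 := fun i hi => by simpa [hS] using hi
  have hmem : ∀ i ∈ S, u i ≠ 0 := fun i hi => (mem_filter.1 hi).2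
  have hpos : 0 < #S := by
    obtain ⟨j, hj⟩ := Function.ne_iff.1 hu0
    exact card_pos.2 ⟨j, by simpa [hS] using hj⟩
  have hcase : #S = 1 ∨ #S = 2 := by omega
  rcases hcase with h | h
  · obtain ⟨j, hj⟩ := card_eq_one.1 h
    refine Or.inl ⟨j, mem_univ j, fun i => ?_⟩
    have h2 := hu i
    rw [subsetSum_eq_sum hsupp, hj, sum_singleton] at h2
    have h3 := hmem j (by simp [hj])
    cases h4 : A i j
    · rfl
    · simp [h4, h3] at h2
  · obtain ⟨j, k, hjk, hS2⟩ := card_eq_two.1 h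
    have h2 := fun i => (subsetSum_eq_sum hsupp (A i)).symm.trans (hu i)
    simp only [hS2, sum_pair hjk] at h2
    have h3 := hmem j (by simp [hS2])
    have h4 := hmem k (by simp [hS2])
    have key : ∀ a b : ZMod 3, a ≠ 0 → b ≠ 0 → ∀ x y : Bool,
        (if x then a else 0) + (if y then b else 0) = 0 → (a = b → x = false) ∧ (a ≠ b → x = y) := by
      decide
    by_cases hab : u j = u k
    · exact Or.inl ⟨j, mem_univ j, fun i => (key _ _ h3 h4 _ _ (h2 i)).1 hab⟩
    · have h5 := fun i => (key _ _ h3 h4 _ _ (h2 i)).2 hab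
      rcases lt_or_gt_of_ne hjk with hlt | hlt
      · exact Or.inr (Or.inl ⟨(j, k), by simpa using hlt, h5⟩)
      · exact Or.inr (Or.inl ⟨(k, j), by simpa using hlt, fun i => (h5 i).symm⟩)

lemma two_mul_card_filter_lt (n : ℕ) :
    2 * (#{p : Fin n × Fin n | p.1 < p.2} : ℝ) = n * (n - 1) := by
  have h1 : #{p : Fin n × Fin n | p.1 < p.2} = #{p : Fin n × Fin n | p.2 < p.1} :=
    card_equiv (Equiv.prodComm _ _) (by simp)
  have h2 : (univ : Finset (Fin n)).offDiag =
      (univ.filter fun p : Fin n × Fin n => p.1 < p.2) ∪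
        univ.filter fun p : Fin n × Fin n => p.2 < p.1 := by
    ext p; simp [lt_or_lt_iff_ne]
  have h3 := congrArg card h2
  rw [offDiag_card, card_union_of_disjoint (disjoint_filter.2 fun p _ a b => lt_asymm a b), ← h1,
    card_univ, Fintype.card_fin] at h3
  have h4 : n ≤ n * n := Nat.le_mul_self n
  have h5 : ((n * n - n : ℕ) : ℝ) = ((#{p : Fin n × Fin n | p.1 < p.2} +
    #{p : Fin n × Fin n | p.1 < p.2} : ℕ) : ℝ) := congrArg _ h3
  push_cast [Nat.cast_sub h4] at h5
  linarith

lemma sum_pow_unitCount (z : ℝ) :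
    ∑ u : Fin n → ZMod 3, z ^ unitCount u = (1 + 2 * z) ^ n := by
  have := Finset.prod_univ_sum (fun _ : Fin n => (univ : Finset (ZMod 3)))
    (fun _ a => if a ≠ 0 then z else 1)
  rw [Fintype.piFinset_univ] at this
  have h3 : ∑ a : ZMod 3, (if a ≠ 0 then z else 1) = 1 + 2 * z := by
    rw [sum_ite, sum_const, sum_const]
    have e1 : #{a : ZMod 3 | a ≠ 0} = 2 := by decide
    have e2 : #{a : ZMod 3 | ¬ a ≠ 0} = 1 := by decide
    rw [e1, e2]; simp; ring
  rw [h3, prod_const, card_univ, Fintype.card_fin] at this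
  rw [this]
  refine sum_congr rfl fun u _ => ?_
  rw [unitCount_three, prod_ite, prod_const, prod_const_one, mul_one]

lemma card_unitCount_lt_le {y : ℝ} (hy0 : 0 < y) (hy1 : y ≤ 1) (L : ℕ) :
    (#{u : Fin n → ZMod 3 | 3 ≤ unitCount u ∧ L * unitCount u < n} : ℝ) ≤
      ((1 + 2 * y ^ L) / y) ^ n := by
  rw [div_pow, le_div_iff₀ (by positivity), ← sum_pow_unitCount, ← nsmul_eq_mul, ← sum_const]
  refine (sum_le_sum fun u hu => ?_).trans (sum_le_sum_of_subset_of_nonneg (filter_subset _ _)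
    fun u _ _ => by positivity)
  rw [← pow_mul]
  exact pow_le_pow_of_le_one hy0.le hy1 (mem_filter.1 hu).2.2.le

/-- The main terms of the singularity probability come from zero and equal columns. -/
lemma exists_prob_sparseKernel_le (h0 : 0 < t) (h1 : t < 1 / 2) :
    ∃ (L : ℕ) (b : ℝ), 0 < L ∧ 0 < b ∧ b < t ^ 2 + (1 - t) ^ 2 ∧ ∀ n : ℕ,
      prob t (SparseKernel (n := n) L) ≤
        n * (1 - t) ^ n + n * (n - 1) / 2 * (t ^ 2 + (1 - t) ^ 2) ^ n + b ^ n := by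
  have ht : t ≤ 1 := by linarith
  obtain ⟨ρ, hρ0, hρ, hconc⟩ := exists_conc_lt_of_three h0 h1
  set r := t ^ 2 + (1 - t) ^ 2
  have hr : 0 < r := hρ0.trans hρ
  obtain ⟨y, hy, hy1⟩ := exists_between ((div_lt_one hr).2 hρ)
  have hy0 : 0 < y := (div_pos hρ0 hr).trans hy
  have hlim : Tendsto (fun L : ℕ => (1 + 2 * y ^ L) / y * ρ) atTop (nhds ((1 + 2 * 0) / y * ρ)) :=
    ((((tendsto_pow_atTop_nhds_zero_of_lt_one hy0.le hy1).const_mul 2).const_add 1).div_const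
      y).mul_const ρ
  have hlt : (1 + 2 * 0) / y * ρ < r := by
    rw [div_lt_iff₀ hr] at hy
    rw [mul_zero, add_zero, one_div, inv_mul_lt_iff₀ hy0]
    exact hy
  obtain ⟨L, hL, hL0⟩ := ((hlim.eventually_lt_const hlt).and (eventually_gt_atTop 0)).exists
  refine ⟨L, (1 + 2 * y ^ L) / y * ρ, hL0, by positivity, hL, fun n => ?_⟩
  refine (prob_mono h0.le ht fun A => SparseKernel.cases).trans ((prob_or_le h0.le ht _ _).trans ?_)
  have e1 : prob t (fun A : Fin n → Fin n → Bool => ∃ j ∈ (univ : Finset (Fin n)),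
      ∀ i, A i j = false) ≤ n * (1 - t) ^ n := by
    refine (prob_exists_le h0.le ht univ fun j A => ∀ i, A i j = false).trans ?_
    refine (sum_le_card_nsmul univ _ ((1 - t) ^ n) fun j _ => ?_).trans (by simp)
    rw [prob_forall t fun x => x j = false]
    exact pow_le_pow_left₀ (rowProb_nonneg h0.le ht _) (rowProb_eq_false_le h0 h1 j) n
  have e2 : prob t (fun A : Fin n → Fin n → Bool =>
      ∃ p ∈ (univ.filter fun p : Fin n × Fin n => p.1 < p.2), ∀ i, A i p.1 = A i p.2) ≤
      n * (n - 1) / 2 * r ^ n := by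
    refine (prob_exists_le h0.le ht _ fun (p : Fin n × Fin n) (A : Fin n → Fin n → Bool) =>
      ∀ i, A i p.1 = A i p.2).trans ?_
    refine (sum_le_card_nsmul _ _ (r ^ n) fun p hp => ?_).trans
      (by rw [nsmul_eq_mul, ← two_mul_card_filter_lt, mul_div_cancel_left₀ _ two_ne_zero])
    rw [prob_forall t fun x => x p.1 = x p.2]
    exact pow_le_pow_left₀ (rowProb_nonneg h0.le ht _)
      (rowProb_eq_le h0 h1 (mem_filter.1 hp).2.ne) n
  have e3 : prob t (fun A : Fin n → Fin n → Bool =>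
      ∃ u ∈ (univ.filter fun u : Fin n → ZMod 3 => 3 ≤ unitCount u ∧ L * unitCount u < n),
        ∀ i, subsetSum (A i) u = 0) ≤ ((1 + 2 * y ^ L) / y * ρ) ^ n := by
    refine (prob_exists_le h0.le ht _ fun u A => ∀ i, subsetSum (A i) u = 0).trans ?_
    refine (sum_le_card_nsmul _ _ (ρ ^ n) fun u hu => ?_).trans ?_
    · rw [prob_forall t fun x => subsetSum x u = 0, rowProb_eq_conc]
      have h3 := (mem_filter.1 hu).2.1
      rw [unitCount_three] at h3
      exact pow_le_pow_left₀ (conc_nonneg h0.le ht _ _ _) (hconc n u h3 0) n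
    · rw [nsmul_eq_mul, mul_pow]
      exact mul_le_mul_of_nonneg_right (card_unitCount_lt_le hy0 hy1.le L) (by positivity)
  linarith [prob_or_le h0.le ht (fun A : Fin n → Fin n → Bool =>
      ∃ p ∈ (univ.filter fun p : Fin n × Fin n => p.1 < p.2), ∀ i, A i p.1 = A i p.2)
    (fun A => ∃ u ∈ (univ.filter fun u : Fin n → ZMod 3 => 3 ≤ unitCount u ∧ L * unitCount u < n),
        ∀ i, subsetSum (A i) u = 0)]

end

section

variable {t : ℝ} {n : ℕ}

/-! ### Typical rows -/

lemma rowProb_lt_rowWeight_le (h0 : 0 ≤ t) (h1 : t ≤ 1) {l : ℝ} (hl : 0 < l) (n : ℕ) :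
    rowProb t (fun x : Fin n → Bool => l ^ n < rowWeight t x) ≤
      ((t * √t + (1 - t) * √(1 - t)) / √l) ^ n := by
  classical
  have hw : ∀ b : Bool, 0 ≤ (if b then t else 1 - t) := fun b => by split_ifs <;> linarith
  have hsl : √(l ^ n) = √l ^ n := by
    rw [← Real.sqrt_sq (by positivity : 0 ≤ √l ^ n), ← pow_mul, mul_comm, pow_mul,
      Real.sq_sqrt hl.le]
  have hpos : 0 < √l ^ n := by positivity
  rw [div_pow, le_div_iff₀ hpos]
  have hsum : ∑ x : Fin n → Bool, rowWeight t x * √(rowWeight t x) =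
      (t * √t + (1 - t) * √(1 - t)) ^ n := by
    have := Finset.prod_univ_sum (fun _ : Fin n => (univ : Finset Bool))
      (fun _ b => (if b then t else 1 - t) * √(if b then t else 1 - t))
    rw [Fintype.piFinset_univ] at this
    simp only [Fintype.sum_bool, prod_const, card_univ, Fintype.card_fin] at this
    simp only [if_true, Bool.false_eq_true, if_false] at this
    rw [this]
    refine sum_congr rfl fun x _ => ?_
    rw [prod_mul_distrib, ← Real.sqrt_prod _ fun j _ => hw (x j)]
    rfl
  rw [← hsum]
  unfold rowProb
  rw [sum_mul]
  refine sum_le_sum fun x _ => ?_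
  rw [mul_assoc]
  refine mul_le_mul_of_nonneg_left ?_ (rowWeight_nonneg h0 h1 x)
  split_ifs with h
  · rw [one_mul, ← hsl]; exact Real.sqrt_le_sqrt h.le
  · rw [zero_mul]; exact Real.sqrt_nonneg _

/-- There are at least `K` rows satisfying `E`. -/
lemma prob_le_card_filter_le (h0 : 0 ≤ t) (h1 : t ≤ 1) (E : (Fin n → Bool) → Prop)
    [DecidablePred E] {μ : ℝ} (hE : rowProb t E ≤ μ) (K : ℕ) :
    prob t (fun A : Fin n → Fin n → Bool => K ≤ #{i | E (A i)}) ≤ 2 ^ n * μ ^ K := by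
  have h : ∀ A : Fin n → Fin n → Bool, K ≤ #{i | E (A i)} →
      ∃ S ∈ (univ.filter fun S : Finset (Fin n) => #S = K), ∀ i ∈ S, E (A i) := by
    intro A hA
    obtain ⟨S, hS, hSK⟩ := exists_subset_card_eq hA
    exact ⟨S, by simpa using hSK, fun i hi => (mem_filter.1 (hS hi)).2⟩
  refine (prob_mono h0 h1 h).trans ?_
  refine (prob_exists_le h0 h1 _ fun (S : Finset (Fin n)) (A : Fin n → Fin n → Bool) =>
    ∀ i ∈ S, E (A i)).trans ?_
  have hμ : 0 ≤ μ := (rowProb_nonneg h0 h1 E).trans hE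
  refine (sum_le_card_nsmul _ _ (μ ^ K) fun S hS => ?_).trans ?_
  · rw [prob_forall_mem, (mem_filter.1 hS).2]
    exact pow_le_pow_left₀ (rowProb_nonneg h0 h1 E) hE K
  · rw [nsmul_eq_mul]
    refine mul_le_mul_of_nonneg_right ?_ (by positivity)
    have := card_filter_le (univ : Finset (Finset (Fin n))) fun S => #S = K
    rw [card_univ, Fintype.card_finset, Fintype.card_fin] at this
    exact_mod_cast this

/-- The weight of a row restricted to rows of small weight. -/
noncomputable def typicalWeight (t l : ℝ) (x : Fin n → Bool) : ℝ :=
  if rowWeight t x ≤ l ^ n then rowWeight t x else 0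

lemma typicalWeight_nonneg (h0 : 0 ≤ t) (h1 : t ≤ 1) (l : ℝ) (x : Fin n → Bool) :
    0 ≤ typicalWeight t l x := by
  unfold typicalWeight; split_ifs
  exacts [rowWeight_nonneg h0 h1 x, le_rfl]

lemma typicalWeight_le_rowWeight (h0 : 0 ≤ t) (h1 : t ≤ 1) (l : ℝ) (x : Fin n → Bool) :
    typicalWeight t l x ≤ rowWeight t x := by
  unfold typicalWeight; split_ifs
  exacts [le_rfl, rowWeight_nonneg h0 h1 x]

lemma typicalWeight_le_pow {l : ℝ} (hl : 0 ≤ l) (x : Fin n → Bool) :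
    typicalWeight t l x ≤ l ^ n := by
  unfold typicalWeight; split_ifs with h
  exacts [h, by positivity]

lemma rowProb_typical_and_eq {G : Type*} [AddCommGroup G] [DecidableEq G] (l : ℝ) (u : Fin n → G) :
    rowProb t (fun x => rowWeight t x ≤ l ^ n ∧ subsetSum x u = 0) =
      zeroMass (typicalWeight t l) u := by
  classical
  unfold rowProb zeroMass typicalWeight
  refine sum_congr rfl fun x _ => ?_
  by_cases h : rowWeight t x ≤ l ^ n <;> by_cases h' : subsetSum x u = 0 <;> simp [h, h']

lemma zeroMass_nonneg {G : Type*} [AddCommGroup G] [DecidableEq G] {h : (Fin n → Bool) → ℝ}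
    (hh : ∀ x, 0 ≤ h x) (u : Fin n → G) : 0 ≤ zeroMass h u :=
  sum_nonneg fun x _ => mul_nonneg (hh x) (by split_ifs <;> simp)

lemma zeroMass_le_map {G H : Type*} [AddCommGroup G] [DecidableEq G] [AddCommGroup H]
    [DecidableEq H] (f : G →+ H) {h : (Fin n → Bool) → ℝ} (hh : ∀ x, 0 ≤ h x) (u : Fin n → G) :
    zeroMass h u ≤ zeroMass h fun j => f (u j) := by
  refine sum_le_sum fun x _ => mul_le_mul_of_nonneg_left ?_ (hh x)
  rw [subsetSum_map]
  by_cases h' : subsetSum x u = 0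
  · simp [h']
  · simp only [h', if_false]; split_ifs <;> simp

/-! ### Structured kernel vectors modulo powers of `3` -/

/-- All but `K` of the rows have small weight and annihilate a vector modulo `3 ^ j` whose
concentration first becomes large at level `j`. -/
def ConcentratedKernel (t l c : ℝ) (K j : ℕ) (A : Fin n → Fin n → Bool) : Prop :=
  ∃ u : Fin n → ZMod (3 ^ j), c * n ≤ unitCount u ∧
    3 < (3 : ℝ) ^ j * zeroMass (typicalWeight t l) u ∧
    (3 : ℝ) ^ j * zeroMass (typicalWeight t l) u ≤ 9 ∧
    ∃ H : Finset (Fin n), n ≤ #H + K ∧ ∀ i ∈ H, rowWeight t (A i) ≤ l ^ n ∧ subsetSum (A i) u = 0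

lemma prob_concentratedKernel_le (h0 : 0 ≤ t) (h1 : t ≤ 1) {l c β : ℝ} {K j : ℕ}
    (hβ : 0 ≤ β)
    (hcard : open scoped Classical in
      (#{u : Fin n → ZMod (3 ^ j) | c * n ≤ unitCount u ∧
        3 < (3 : ℝ) ^ j * zeroMass (typicalWeight t l) u} : ℝ) ≤ ((3 : ℝ) ^ j) ^ n * β ^ n) :
    prob t (ConcentratedKernel (n := n) t l c K j) ≤ (18 * β) ^ n * ((3 : ℝ) ^ j) ^ K := by
  classical
  let S : Finset ((Fin n → ZMod (3 ^ j)) × Finset (Fin n)) :=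
    (univ.filter fun u => (c * n ≤ unitCount u ∧
        3 < (3 : ℝ) ^ j * zeroMass (typicalWeight t l) u) ∧
        (3 : ℝ) ^ j * zeroMass (typicalWeight t l) u ≤ 9) ×ˢ
      univ.filter fun H => n ≤ #H + K
  have hmono : ∀ A : Fin n → Fin n → Bool, ConcentratedKernel t l c K j A →
      ∃ p ∈ S, ∀ i ∈ p.2, rowWeight t (A i) ≤ l ^ n ∧ subsetSum (A i) p.1 = 0 := by
    rintro A ⟨u, hu1, hu2, hu3, H, hH, hA⟩
    exact ⟨(u, H), by simp [S, hu1, hu2, hu3, hH], hA⟩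
  refine (prob_mono h0 h1 hmono).trans ?_
  refine (prob_exists_le h0 h1 S fun (p : (Fin n → ZMod (3 ^ j)) × Finset (Fin n))
    (A : Fin n → Fin n → Bool) => ∀ i ∈ p.2, rowWeight t (A i) ≤ l ^ n ∧
      subsetSum (A i) p.1 = 0).trans ?_
  have hterm : ∀ p ∈ S, prob t (fun A : Fin n → Fin n → Bool => ∀ i ∈ p.2,
      rowWeight t (A i) ≤ l ^ n ∧ subsetSum (A i) p.1 = 0) ≤
      (9 / 3 ^ j) ^ n * ((3 : ℝ) ^ j) ^ K := by
    intro p hp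
    rw [prob_forall_mem t p.2 fun x => rowWeight t x ≤ l ^ n ∧ subsetSum x p.1 = 0,
      rowProb_typical_and_eq]
    obtain ⟨hp1, hp2⟩ := mem_product.1 hp
    have hp1 := (mem_filter.1 hp1).2.2
    have hp2 := (mem_filter.1 hp2).2
    set F := zeroMass (typicalWeight t l) p.1
    have hF0 : 0 ≤ F := zeroMass_nonneg (typicalWeight_nonneg h0 h1 l) _
    have hF1 : F ≤ 1 := (zeroMass_le_conc (typicalWeight_le_rowWeight h0 h1 l) _).trans
      (conc_le_one h0 h1 _ _ _)
    have h3 : (0 : ℝ) < 3 ^ j := by positivity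
    have hF2 : F ≤ 9 / 3 ^ j := by rw [le_div_iff₀ h3]; linarith
    have hcl : #p.2 ≤ n := by simpa using card_le_univ p.2
    by_cases h9 : (9 : ℝ) / 3 ^ j ≤ 1
    · calc F ^ #p.2 ≤ (9 / 3 ^ j) ^ #p.2 := pow_le_pow_left₀ hF0 hF2 _
        _ ≤ (9 / 3 ^ j) ^ #p.2 * ((9 / 3 ^ j) * 3 ^ j) ^ (n - #p.2) := by
          refine le_mul_of_one_le_right (by positivity) (one_le_pow₀ ?_)
          rw [div_mul_cancel₀ _ h3.ne']; norm_num
        _ = (9 / 3 ^ j) ^ n * (3 ^ j) ^ (n - #p.2) := by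
          rw [mul_pow, ← mul_assoc, ← pow_add, Nat.add_sub_cancel' hcl]
        _ ≤ _ := mul_le_mul_of_nonneg_left (pow_le_pow_right₀ (one_le_pow₀ (by norm_num))
          (by omega)) (by positivity)
    · refine (pow_le_one₀ hF0 hF1).trans (one_le_mul_of_one_le_of_one_le
        (one_le_pow₀ (not_le.1 h9).le) (one_le_pow₀ (one_le_pow₀ (by norm_num))))
  refine (sum_le_card_nsmul _ _ _ hterm).trans ?_
  rw [nsmul_eq_mul, card_product, Nat.cast_mul]
  have hc1 : (#(univ.filter fun u : Fin n → ZMod (3 ^ j) => (c * n ≤ unitCount u ∧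
        3 < (3 : ℝ) ^ j * zeroMass (typicalWeight t l) u) ∧
        (3 : ℝ) ^ j * zeroMass (typicalWeight t l) u ≤ 9) : ℝ) ≤ ((3 : ℝ) ^ j) ^ n * β ^ n := by
    refine le_trans ?_ hcard
    refine Nat.cast_le.2 (card_le_card fun u hu => ?_)
    simp only [mem_filter] at hu ⊢
    exact ⟨hu.1, hu.2.1⟩
  have hc2 : (#(univ.filter fun H : Finset (Fin n) => n ≤ #H + K) : ℝ) ≤ 2 ^ n := by
    have := card_filter_le (univ : Finset (Finset (Fin n))) fun H => n ≤ #H + K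
    rw [card_univ, Fintype.card_finset, Fintype.card_fin] at this
    exact_mod_cast this
  calc _ ≤ (((3 : ℝ) ^ j) ^ n * β ^ n) * 2 ^ n * ((9 / 3 ^ j) ^ n * ((3 : ℝ) ^ j) ^ K) := by
        gcongr
    _ = _ := by
      rw [← mul_assoc, ← mul_pow, ← mul_pow, ← mul_pow]
      congr 2
      field_simp
      ring

end

section

/-! ### Kernel vectors determined by all rows but one -/

variable {t : ℝ} {n : ℕ}

/-- An integer vector, not divisible by `3`, in the kernel of all rows but row `i`. -/
noncomputable def kernelVector (i : Fin n) (A : Fin n → Fin n → Bool) : Fin n → ℤ :=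
  Classical.epsilon fun v => (∃ j, ¬ 3 ∣ v j) ∧ ∀ k, k ≠ i → subsetSum (A k) v = 0

lemma kernelVector_update (i : Fin n) (A : Fin n → Fin n → Bool) (x : Fin n → Bool) :
    kernelVector i (Function.update A i x) = kernelVector i A := by
  unfold kernelVector
  congr 1
  ext v
  refine and_congr_right fun _ => forall₂_congr fun k hk => ?_
  rw [Function.update_of_ne hk]

/-- Row `i` annihilates a vector determined by the other rows whose concentration modulo `3 ^ J`
is small. -/
def RowInKernel (t l : ℝ) (J : ℕ) (i : Fin n) (A : Fin n → Fin n → Bool) : Prop :=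
  rowWeight t (A i) ≤ l ^ n ∧ subsetSum (A i) (kernelVector i A) = 0 ∧
    (3 : ℝ) ^ J * zeroMass (typicalWeight t l)
      (fun k => ((kernelVector i A k : ℤ) : ZMod (3 ^ J))) ≤ 3

lemma subsetSum_intCast (Q : ℕ) (x : Fin n → Bool) (v : Fin n → ℤ) :
    subsetSum x (fun k => (v k : ZMod Q)) = ((subsetSum x v : ℤ) : ZMod Q) :=
  subsetSum_map (Int.castAddHom (ZMod Q)) x v

lemma rowProb_mono (h0 : 0 ≤ t) (h1 : t ≤ 1) {E E' : (Fin n → Bool) → Prop}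
    (h : ∀ x, E x → E' x) : rowProb t E ≤ rowProb t E' := by
  classical
  refine sum_le_sum fun x _ => mul_le_mul_of_nonneg_left ?_ (rowWeight_nonneg h0 h1 x)
  by_cases hE : E x
  · simp [hE, h x hE]
  · simp only [hE, if_false]; split_ifs <;> simp

lemma prob_rowInKernel_le (h0 : 0 ≤ t) (h1 : t ≤ 1) (l : ℝ) (J : ℕ) (i : Fin n) :
    prob t (RowInKernel t l J i) ≤ 3 / 3 ^ J := by
  have h3 : (0 : ℝ) < 3 ^ J := by positivity
  refine prob_le_of_update h0 h1 i fun A => ?_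
  set u : Fin n → ZMod (3 ^ J) := fun k => ((kernelVector i A k : ℤ) : ZMod (3 ^ J)) with hu
  by_cases hF : (3 : ℝ) ^ J * zeroMass (typicalWeight t l) u ≤ 3
  · refine (rowProb_mono h0 h1
      (E' := fun x => rowWeight t x ≤ l ^ n ∧ subsetSum x u = 0) fun x hx => ?_).trans ?_
    · obtain ⟨hx1, hx2, -⟩ := hx
      rw [kernelVector_update, Function.update_self] at hx2
      rw [Function.update_self] at hx1
      exact ⟨hx1, by rw [hu, subsetSum_intCast, hx2, Int.cast_zero]⟩
    · rw [rowProb_typical_and_eq, le_div_iff₀ h3]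
      linarith
  · have : (fun x => RowInKernel t l J i (Function.update A i x)) = fun _ => False := by
      ext x
      simp only [iff_false]
      rintro ⟨-, -, hx⟩
      rw [kernelVector_update] at hx
      exact hF hx
    rw [this]
    simp only [rowProb, if_false, mul_zero, sum_const_zero]
    positivity

/-! ### Singular matrices -/

/-- The real `0`/`1` matrix of a Boolean matrix. -/
def toReal (A : Fin n → Fin n → Bool) : Matrix (Fin n) (Fin n) ℝ :=
  of fun i j => if A i j then 1 else 0

lemma det_toReal_swap (A : Fin n → Fin n → Bool) :
    (toReal (Function.swap A)).det = (toReal A).det := by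
  rw [← det_transpose]; rfl

lemma exists_int_kernel {A : Fin n → Fin n → Bool} (hA : (toReal A).det = 0) :
    ∃ v : Fin n → ℤ, (∃ j, ¬ 3 ∣ v j) ∧ ∀ i, subsetSum (A i) v = 0 := by
  let M : Matrix (Fin n) (Fin n) ℤ := of fun i j => if A i j then 1 else 0
  have hM : M.det = 0 := by
    have h : (Int.castRingHom ℝ).mapMatrix M = toReal A := by
      ext i j
      simp only [RingHom.mapMatrix_apply, Matrix.map_apply, M, toReal, of_apply]
      split_ifs <;> simp
    rw [← h, ← RingHom.map_det] at hA
    simpa using hA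
  obtain ⟨v, hv0, hv⟩ := exists_mulVec_eq_zero_iff.2 hM
  have hMv : ∀ i, subsetSum (A i) v = 0 := fun i => by
    have := congrFun hv i
    simpa [mulVec, dotProduct, M, subsetSum] using this
  obtain ⟨j, hj⟩ := Function.ne_iff.1 hv0
  obtain ⟨g, hg, hg1⟩ := Finset.extract_gcd v ⟨j, mem_univ j⟩
  have hd : univ.gcd v ≠ 0 := fun h => hj (by rw [hg j (mem_univ j), h, zero_mul]; rfl)
  refine ⟨g, ?_, fun i => ?_⟩
  · by_contra! h
    have : (3 : ℤ) ∣ univ.gcd g := Finset.dvd_gcd fun k _ => h k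
    rw [hg1] at this
    norm_num at this
  · have h2 := hMv i
    rw [show v = fun k => univ.gcd v * g k from funext fun k => hg k (mem_univ k),
      subsetSum_mul] at h2
    exact (mul_eq_zero.1 h2).resolve_left hd

lemma sum_mul_subsetSum (A : Fin n → Fin n → Bool) (w v : Fin n → ℤ) :
    ∑ i, w i * subsetSum (A i) v = ∑ j, v j * subsetSum (Function.swap A j) w := by
  simp only [subsetSum, mul_sum, Function.swap]
  rw [sum_comm]
  refine sum_congr rfl fun j _ => sum_congr rfl fun i _ => ?_
  split_ifs <;> ring

lemma lt_unitCount_of_not_sparseKernel {L : ℕ} {A : Fin n → Fin n → Bool}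
    (hA : ¬ SparseKernel L A) {v : Fin n → ℤ} (hv3 : ∃ j, ¬ 3 ∣ v j)
    (hv : ∀ i, subsetSum (A i) v = 0) : n ≤ L * unitCount fun k => (v k : ZMod 3) := by
  by_contra! h
  refine hA ⟨fun k => (v k : ZMod 3), ?_, h, fun i => by
    rw [subsetSum_intCast, hv i, Int.cast_zero]⟩
  obtain ⟨j, hj⟩ := hv3
  exact Function.ne_iff.2 ⟨j, fun h => hj ((ZMod.intCast_zmod_eq_zero_iff_dvd _ 3).1 h)⟩

lemma unitCount_three_le_pow (v : Fin n → ℤ) (j : ℕ) :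
    (unitCount fun k => (v k : ZMod 3)) ≤ unitCount fun k => (v k : ZMod (3 ^ j)) := by
  refine card_le_card fun k hk => ?_
  simp only [mem_filter, mem_univ, true_and, ZMod.coe_int_isUnit_iff_isCoprime] at hk ⊢
  push_cast at hk ⊢
  exact hk.pow_left

lemma cases_of_det_eq_zero (h0 : 0 ≤ t) (h1 : t ≤ 1) (l : ℝ) {L K : ℕ} (J : ℕ) (hL : 0 < L)
    (hn : L * K < n) {A : Fin n → Fin n → Bool} (hA : (toReal A).det = 0) :
    SparseKernel L A ∨ SparseKernel L (Function.swap A) ∨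
      K + 1 ≤ #{i | l ^ n < rowWeight t (A i)} ∨
      (∃ j ∈ range (J + 1), ConcentratedKernel t l (1 / L) K j A) ∨
      ∃ i ∈ (univ : Finset (Fin n)), RowInKernel t l J i A := by
  by_contra! h
  obtain ⟨hs, hs', hK, hC, hR⟩ := h
  obtain ⟨v, hv3, hv⟩ := exists_int_kernel hA
  obtain ⟨w, hw3, hw⟩ := exists_int_kernel ((det_toReal_swap A).trans hA)
  have hwc := lt_unitCount_of_not_sparseKernel hs' hw3 hw
  obtain ⟨i, hwi, hi⟩ : ∃ i, (w i : ZMod 3) ≠ 0 ∧ rowWeight t (A i) ≤ l ^ n := by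
    by_contra! h
    have h2 : (unitCount fun k => (w k : ZMod 3)) ≤ #{i | l ^ n < rowWeight t (A i)} := by
      rw [unitCount_three]
      exact card_le_card fun k hk => by
        simp only [mem_filter, mem_univ, true_and] at hk ⊢
        exact h k hk
    have h3 : L * (unitCount fun k => (w k : ZMod 3)) ≤ L * K :=
      Nat.mul_le_mul_left L (by omega)
    omega
  obtain ⟨hV3, hV⟩ : (∃ j, ¬ 3 ∣ kernelVector i A j) ∧
      ∀ k, k ≠ i → subsetSum (A k) (kernelVector i A) = 0 :=
    Classical.epsilon_spec (p := fun v => (∃ j, ¬ 3 ∣ v j) ∧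
      ∀ k, k ≠ i → subsetSum (A k) v = 0) ⟨v, hv3, fun k _ => hv k⟩
  set V := kernelVector i A with hVdef
  have hVi : subsetSum (A i) V = 0 := by
    have h2 := sum_mul_subsetSum A w V
    rw [sum_eq_zero (f := fun j => V j * _) fun j _ => by rw [hw j, mul_zero],
      sum_eq_single i (fun k _ hk => by rw [hV k hk, mul_zero]) (by simp)] at h2
    exact (mul_eq_zero.1 h2).resolve_left fun h => hwi (by rw [h, Int.cast_zero])
  have hVall : ∀ k, subsetSum (A k) V = 0 := fun k => by
    by_cases hk : k = i
    · rw [hk, hVi]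
    · exact hV k hk
  have hVc := lt_unitCount_of_not_sparseKernel hs hV3 hVall
  have hL' : (0 : ℝ) < L := by exact_mod_cast hL
  have hF : ∀ j ≤ J, (3 : ℝ) ^ j *
      zeroMass (typicalWeight t l) (fun k => (V k : ZMod (3 ^ j))) ≤ 3 := by
    intro j
    induction j with
    | zero =>
      intro _
      have := (zeroMass_le_conc (typicalWeight_le_rowWeight h0 h1 l)
        (fun k => (V k : ZMod (3 ^ 0)))).trans (conc_le_one h0 h1 _ _ _)
      linarith
    | succ j ih =>
      intro hj
      by_contra! hgt
      refine hC (j + 1) (by simp; omega) ⟨fun k => (V k : ZMod (3 ^ (j + 1))), ?_, hgt, ?_,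
        univ.filter fun k => rowWeight t (A k) ≤ l ^ n, ?_, fun k hk => ?_⟩
      · rw [one_div, inv_mul_le_iff₀ hL']
        exact_mod_cast hVc.trans (Nat.mul_le_mul_left L (unitCount_three_le_pow V (j + 1)))
      · have h2 := zeroMass_le_map (ZMod.castHom (pow_dvd_pow 3 (Nat.le_succ j))
          (ZMod (3 ^ j)) : ZMod (3 ^ (j + 1)) →+ ZMod (3 ^ j)) (typicalWeight_nonneg h0 h1 l)
          (fun k => (V k : ZMod (3 ^ (j + 1))))
        simp only [AddMonoidHom.coe_coe, map_intCast] at h2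
        have h3 := mul_le_mul_of_nonneg_left h2 (by positivity : (0 : ℝ) ≤ 3 ^ (j + 1))
        have h4 := ih (by omega)
        rw [pow_succ] at h3 ⊢
        linarith
      · have h2 := card_filter_add_card_filter_not (s := (univ : Finset (Fin n)))
          fun k => rowWeight t (A k) ≤ l ^ n
        simp only [not_le, card_univ, Fintype.card_fin] at h2
        omega
      · exact ⟨(mem_filter.1 hk).2, by rw [subsetSum_intCast, hVall k, Int.cast_zero]⟩
  exact hR i (mem_univ i) ⟨hi, hVi, hF J le_rfl⟩

end

section

/-! ### The bound on the singularity probability -/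

variable {t : ℝ}

lemma sq_add_sqrt_lt (h0 : 0 < t) (h1 : t < 1 / 2) :
    (t * √t + (1 - t) * √(1 - t)) ^ 2 < t ^ 2 + (1 - t) ^ 2 := by
  have hlt : √t < √(1 - t) := Real.sqrt_lt_sqrt h0.le (by linarith)
  have e1 : √t ^ 2 = t := Real.sq_sqrt h0.le
  have e2 : √(1 - t) ^ 2 = 1 - t := Real.sq_sqrt (by linarith)
  have h : 0 < t * (1 - t) * (√(1 - t) - √t) ^ 2 :=
    mul_pos (mul_pos h0 (by linarith)) (pow_pos (sub_pos.2 hlt) 2)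
  have e : t ^ 2 + (1 - t) ^ 2 - (t * √t + (1 - t) * √(1 - t)) ^ 2 =
      t * (1 - t) * (√(1 - t) - √t) ^ 2 := by
    linear_combination (-t ^ 2 - t * (1 - t)) * e1 + (-(1 - t) ^ 2 - t * (1 - t)) * e2
  linarith

lemma prob_concentratedKernel_sum_le (h0 : 0 < t) (h1 : t < 1 / 2) {l s c r : ℝ} (hl : 0 < l)
    (hls : l < s) (hc : 0 < c) (hr : 0 < r) (K : ℕ) :
    ∀ᶠ n : ℕ in atTop, ∀ J : ℕ, (3 : ℝ) ^ J ≤ s⁻¹ ^ n →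
      ∑ j ∈ range (J + 1), prob t (ConcentratedKernel (n := n) t l c K j) ≤ (r / 2) ^ n := by
  have ht : t ≤ 1 := by linarith
  have hs : 0 < s := hl.trans hls
  set η := r * s ^ (K + 1) / 36 with hη
  have hη0 : 0 < η := by positivity
  filter_upwards [eventually_card_zeroMass_gt_le h0 h1 hη0 (div_pos hl hs)
    ((div_lt_one hs).2 hls) hc] with n hn J hJ
  have hterm : ∀ j ∈ range (J + 1), prob t (ConcentratedKernel (n := n) t l c K j) ≤
      (18 * η) ^ n * (s⁻¹ ^ n) ^ K := by
    intro j hj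
    have hj3 : (3 : ℝ) ^ j ≤ s⁻¹ ^ n :=
      (pow_le_pow_right₀ (by norm_num) (Nat.lt_succ_iff.1 (mem_range.1 hj))).trans hJ
    refine (prob_concentratedKernel_le h0.le ht hη0.le (hn (typicalWeight t l) (l ^ n) j
      (typicalWeight_nonneg h0.le ht l) (typicalWeight_le_rowWeight h0.le ht l)
      (typicalWeight_le_pow hl.le) ?_)).trans ?_
    · rw [div_eq_inv_mul, mul_pow]
      exact mul_le_mul_of_nonneg_right hj3 (by positivity)
    · exact mul_le_mul_of_nonneg_left (pow_le_pow_left₀ (by positivity) hj3 K) (by positivity)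
  refine (sum_le_card_nsmul _ _ _ hterm).trans ?_
  rw [nsmul_eq_mul, card_range]
  have hJ' : ((J + 1 : ℕ) : ℝ) ≤ s⁻¹ ^ n := by
    refine le_trans ?_ hJ
    exact_mod_cast (Nat.lt_pow_self (by norm_num) : J < 3 ^ J)
  calc _ ≤ s⁻¹ ^ n * ((18 * η) ^ n * (s⁻¹ ^ n) ^ K) :=
        mul_le_mul_of_nonneg_right hJ' (by positivity)
    _ = (s⁻¹ * (18 * η * s⁻¹ ^ K)) ^ n := by
      rw [mul_pow s⁻¹, mul_pow (18 * η), ← pow_mul, ← pow_mul, mul_comm n K]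
    _ = (r / 2) ^ n := by
      congr 1
      rw [hη, pow_succ, inv_pow]
      field_simp
      ring

lemma prob_or_le_add {n : ℕ} (h0 : 0 ≤ t) (h1 : t ≤ 1) {E E' : (Fin n → Fin n → Bool) → Prop}
    {a b : ℝ} (hE : prob t E ≤ a) (hE' : prob t E' ≤ b) :
    prob t (fun A => E A ∨ E' A) ≤ a + b :=
  (prob_or_le h0 h1 E E').trans (add_le_add hE hE')

/-- The singularity probability is dominated by zero and equal rows and columns. -/
lemma exists_prob_det_eq_zero_le (h0 : 0 < t) (h1 : t < 1 / 2) :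
    ∃ b : ℝ, 0 < b ∧ b < t ^ 2 + (1 - t) ^ 2 ∧ ∀ᶠ n : ℕ in atTop,
      prob t (fun A : Fin n → Fin n → Bool => (toReal A).det = 0) ≤
        2 * n * (1 - t) ^ n + n * (n - 1) * (t ^ 2 + (1 - t) ^ 2) ^ n + 13 * n * b ^ n := by
  have ht : t ≤ 1 := by linarith
  have ht' : 0 < 1 - t := by linarith
  obtain ⟨L, b₁, hL, hb₁, hb₁r, hsparse⟩ := exists_prob_sparseKernel_le h0 h1
  have hMr := sq_add_sqrt_lt h0 h1
  set m := t * √t + (1 - t) * √(1 - t) with hm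
  have hm0 : 0 < m := by positivity
  have hr1 : t ^ 2 + (1 - t) ^ 2 < 1 := by nlinarith
  set r := t ^ 2 + (1 - t) ^ 2 with hr
  have hr0 : 0 < r := by positivity
  obtain ⟨l, hml, hlr⟩ := exists_between hMr
  obtain ⟨s, hls, hsr⟩ := exists_between hlr
  have hl : 0 < l := (sq_nonneg m).trans_lt hml
  have hs : 0 < s := hl.trans hls
  have hμ1 : m / √l < 1 := (div_lt_one (Real.sqrt_pos.2 hl)).2 (Real.lt_sqrt_of_sq_lt hml)
  have hμ0 : 0 < m / √l := by positivity
  obtain ⟨K, hK⟩ := exists_pow_lt_of_lt_one (half_pos hr0) hμ1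
  have hK' : 2 * (m / √l) ^ (K + 1) < r := by
    have := pow_le_pow_of_le_one hμ0.le hμ1.le (K.le_add_right 1)
    linarith
  set b := max (max b₁ (2 * (m / √l) ^ (K + 1))) (max (r / 2) s) with hb
  have hbb₁ : b₁ ≤ b := (le_max_left _ _).trans (le_max_left _ _)
  have hbμ : 2 * (m / √l) ^ (K + 1) ≤ b := (le_max_right _ _).trans (le_max_left _ _)
  have hbr : r / 2 ≤ b := (le_max_left _ _).trans (le_max_right _ _)
  have hbs : s ≤ b := (le_max_right _ _).trans (le_max_right _ _)
  refine ⟨b, hb₁.trans_le hbb₁, max_lt (max_lt hb₁r hK') (max_lt (by linarith) hsr), ?_⟩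
  have hL' : (0 : ℝ) < 1 / L := by
    have : (0 : ℝ) < L := by exact_mod_cast hL
    positivity
  filter_upwards [prob_concentratedKernel_sum_le h0 h1 hl hls hL' hr0 K,
    eventually_gt_atTop (L * K)] with n hconc hn
  have hn1 : (1 : ℝ) ≤ n := by exact_mod_cast (Nat.zero_le _).trans_lt hn
  obtain ⟨J, hJ, hJ'⟩ := exists_nat_pow_near (one_le_pow₀ (n := n)
    ((one_le_inv₀ hs).2 (hsr.trans hr1).le)) (by norm_num : (1 : ℝ) < 3)
  refine (prob_mono h0.le ht fun A hA => cases_of_det_eq_zero h0.le ht l J hL hn hA).trans ?_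
  have p1 := hsparse n
  have p2 := (prob_swap t (SparseKernel (n := n) L)).le.trans p1
  have p3 := prob_le_card_filter_le h0.le ht _ (rowProb_lt_rowWeight_le h0.le ht hl n) (K + 1)
  have p4 := (prob_exists_le h0.le ht (range (J + 1))
    fun j => ConcentratedKernel (n := n) t l (1 / L) K j).trans (hconc J hJ)
  have p5 := (prob_exists_le h0.le ht (univ : Finset (Fin n))
    fun i => RowInKernel t l J i).trans (sum_le_card_nsmul _ _ _ fun i _ =>
      prob_rowInKernel_le h0.le ht l J i)
  rw [nsmul_eq_mul, card_univ, Fintype.card_fin] at p5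
  have q1 : b₁ ^ n ≤ b ^ n := pow_le_pow_left₀ hb₁.le hbb₁ n
  have q3 : 2 ^ n * ((m / √l) ^ n) ^ (K + 1) ≤ b ^ n := by
    rw [← pow_mul, mul_comm n, pow_mul, ← mul_pow]
    exact pow_le_pow_left₀ (by positivity) hbμ n
  have q4 : (r / 2) ^ n ≤ b ^ n := pow_le_pow_left₀ (by positivity) hbr n
  have q5 : (n : ℝ) * (3 / 3 ^ J) ≤ n * (9 * b ^ n) := by
    refine mul_le_mul_of_nonneg_left ?_ (by linarith)
    have h5 : s ^ n ≤ b ^ n := pow_le_pow_left₀ hs.le hbs n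
    rw [inv_pow, inv_lt_iff_one_lt_mul₀ (by positivity), pow_succ] at hJ'
    rw [div_le_iff₀ (by positivity)]
    have h6 : 3 * 1 ≤ 3 * (s ^ n * (3 ^ J * 3)) :=
      mul_le_mul_of_nonneg_left (by linarith) (by norm_num)
    have h7 := mul_le_mul_of_nonneg_right h5 (by positivity : (0 : ℝ) ≤ 9 * 3 ^ J)
    linarith
  have q6 : b ^ n ≤ n * b ^ n :=
    le_mul_of_one_le_left (pow_nonneg (hs.le.trans hbs) n) hn1
  rw [← hm] at p3
  refine (prob_or_le_add h0.le ht p1 (prob_or_le_add h0.le ht p2 (prob_or_le_add h0.le ht p3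
    (prob_or_le_add h0.le ht p4 p5)))).trans ?_
  linarith

end

section

/-! ### Passage to the limit -/

variable {t : ℝ}

lemma sum_filter_eq_prob (t : ℝ) (N : ℕ) (E : (Fin N → Fin N → Bool) → Prop) [DecidablePred E] :
    (∑ A ∈ (Finset.univ : Finset (Fin N → Fin N → Bool)).filter E,
      ∏ i : Fin N, ∏ j : Fin N, (if A i j then t else 1 - t)) = prob t E := by
  unfold prob rowWeight
  rw [sum_filter]
  exact sum_congr rfl fun A _ => by by_cases h : E A <;> simp [h]

lemma prob_det_eq_zero_zero (t : ℝ) :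
    prob t (fun A : Fin 0 → Fin 0 → Bool => (toReal A).det = 0) = 0 := by
  simp [prob]

lemma prob_det_eq_zero_one_le (h0 : 0 < t) (h1 : t < 1 / 2) :
    prob t (fun A : Fin 1 → Fin 1 → Bool => (toReal A).det = 0) ≤ 1 - t := by
  have ht : t ≤ 1 := by linarith
  refine (prob_mono h0.le ht (E' := fun A => ∀ i, A i 0 = false) fun A hA i => ?_).trans ?_
  · rw [Subsingleton.elim i 0]
    simpa [toReal] using hA
  · rw [prob_forall t fun x => x 0 = false, pow_one]
    exact rowProb_eq_false_le h0 h1 0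

theorem exists_singular_bound (h0 : 0 < t) (h1 : t < 1 / 2) :
    ∃ ε : ℕ → ℝ, Tendsto ε atTop (nhds 0) ∧
      (∀ N : ℕ, prob t (fun A : Fin N → Fin N → Bool => (toReal A).det = 0) ≤
        2 * N * (1 - t) ^ N + (1 + ε N) * N * ((N : ℝ) - 1) * (t ^ 2 + (1 - t) ^ 2) ^ N) ∧
      Tendsto (fun N : ℕ => prob t (fun A : Fin N → Fin N → Bool => (toReal A).det ≠ 0))
        atTop (nhds 1) := by
  obtain ⟨b, hb0, hbr, hb⟩ := exists_prob_det_eq_zero_le h0 h1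
  have ht : t ≤ 1 := by linarith
  have hr1 : t ^ 2 + (1 - t) ^ 2 < 1 := by nlinarith
  set r := t ^ 2 + (1 - t) ^ 2
  have hr0 : 0 < r := hb0.trans hbr
  let P : ℕ → ℝ := fun N => prob t (fun A : Fin N → Fin N → Bool => (toReal A).det = 0)
  have hD : ∀ {N : ℕ}, 2 ≤ N → (0 : ℝ) < N * (N - 1) * r ^ N := fun {N} hN => by
    have : (2 : ℝ) ≤ N := by exact_mod_cast hN
    exact mul_pos (mul_pos (by linarith) (by linarith)) (by positivity)
  have hε : Tendsto (fun N : ℕ => max 0 ((P N - 2 * N * (1 - t) ^ N) / (N * (N - 1) * r ^ N) - 1))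
      atTop (nhds 0) := by
    have hlim : Tendsto (fun N : ℕ => 13 * (b / r) ^ N) atTop (nhds 0) := by
      simpa using (tendsto_pow_atTop_nhds_zero_of_lt_one (by positivity)
        ((div_lt_one hr0).2 hbr)).const_mul 13
    refine tendsto_of_tendsto_of_tendsto_of_le_of_le' tendsto_const_nhds hlim
      (Eventually.of_forall fun _ => le_max_left _ _) ?_
    filter_upwards [hb, eventually_ge_atTop 2] with N hN hN2
    refine max_le (by positivity) ?_
    rw [sub_le_iff_le_add, div_le_iff₀ (hD hN2)]
    have h2 : (2 : ℝ) ≤ N := by exact_mod_cast hN2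
    have h3 : 13 * (b / r) ^ N * (N * (N - 1) * r ^ N) = 13 * N * b ^ N * (N - 1) := by
      rw [div_pow]; field_simp
    have h4 : 13 * N * b ^ N * 1 ≤ 13 * N * b ^ N * (N - 1) :=
      mul_le_mul_of_nonneg_left (by linarith) (by positivity)
    rw [add_mul, h3]
    have hN : P N ≤ _ := hN
    linarith
  refine ⟨_, hε, fun N => ?_, ?_⟩
  · rcases Nat.lt_or_ge N 2 with h | h
    · interval_cases N
      · simpa using (prob_det_eq_zero_zero t).le
      · have := prob_det_eq_zero_one_le h0 h1
        simp only [Nat.cast_one, sub_self, mul_zero, zero_mul, pow_one, mul_one, add_zero]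
        linarith
    · have h2 := (sub_le_iff_le_add.1 (le_max_right 0
        ((P N - 2 * N * (1 - t) ^ N) / (N * (N - 1) * r ^ N) - 1)))
      rw [div_le_iff₀ (hD h)] at h2
      change P N ≤ _
      linarith
  · have hP : Tendsto P atTop (nhds 0) := by
      have k1 : Tendsto (fun N : ℕ => (N : ℝ) * (1 - t) ^ N) atTop (nhds 0) :=
        tendsto_self_mul_const_pow_of_lt_one (by linarith) (by linarith)
      have k2 : Tendsto (fun N : ℕ => (N : ℝ) ^ 2 * r ^ N) atTop (nhds 0) :=
        tendsto_pow_const_mul_const_pow_of_lt_one 2 hr0.le hr1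
      have k3 : Tendsto (fun N : ℕ => (N : ℝ) * b ^ N) atTop (nhds 0) :=
        tendsto_self_mul_const_pow_of_lt_one hb0.le (hbr.trans hr1)
      have k := ((k1.const_mul 2).add k2).add (k3.const_mul 13)
      simp only [mul_zero, add_zero] at k
      refine tendsto_of_tendsto_of_tendsto_of_le_of_le' tendsto_const_nhds k
        (Eventually.of_forall fun _ => prob_nonneg h0.le ht _) ?_
      filter_upwards [hb] with N hN
      have h4 : (0 : ℝ) ≤ N * r ^ N := by positivity
      have hN : P N ≤ _ := hN
      linarith
    have e : (fun N : ℕ => prob t (fun A : Fin N → Fin N → Bool => (toReal A).det ≠ 0)) =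
        fun N => 1 - P N :=
      funext fun N => eq_sub_of_add_eq' (prob_add_prob_not t _)
    rw [e]
    simpa using hP.const_sub 1

end

end BernoulliMatrix

open scoped Classical in
/-- Theorem 3, part 2: fix `t ∈ (0, 1/2)` and let `P_N` be a random `N × N` matrix with
i.i.d. `{0,1}`-entries equal to `1` with probability `t` (an outcome `A : Fin N → Fin N →
Bool` has probability `∏_{i,j} (t if A i j else 1-t)`).  Then there is a sequence
`ε_N → 0` such that the probability that `P_N` is singular over `ℝ` is at most
`2N(1-t)^N + (1+ε_N) N(N-1) (t² + (1-t)²)^N`; in particular, the probability that `P_N`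
is invertible converges to `1` as `N → ∞`. -/
theorem iid_random_selection_full_rank (t : ℝ) (ht0 : 0 < t) (ht1 : t < 1 / 2) :
    ∃ ε : ℕ → ℝ, Tendsto ε atTop (nhds 0) ∧
      (∀ N : ℕ,
        (∑ A ∈ (Finset.univ : Finset (Fin N → Fin N → Bool)).filter
              (fun A => (Matrix.of fun i j : Fin N => if A i j then (1 : ℝ) else 0).det = 0),
            ∏ i : Fin N, ∏ j : Fin N, (if A i j then t else 1 - t))
          ≤ 2 * N * (1 - t) ^ N
            + (1 + ε N) * N * ((N : ℝ) - 1) * (t ^ 2 + (1 - t) ^ 2) ^ N) ∧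
      Tendsto (fun N : ℕ =>
          ∑ A ∈ (Finset.univ : Finset (Fin N → Fin N → Bool)).filter
              (fun A => (Matrix.of fun i j : Fin N => if A i j then (1 : ℝ) else 0).det ≠ 0),
            ∏ i : Fin N, ∏ j : Fin N, (if A i j then t else 1 - t))
        atTop (nhds 1) := by
  obtain ⟨ε, hε, hle, hlim⟩ := BernoulliMatrix.exists_singular_bound ht0 ht1
  refine ⟨ε, hε, fun N => ?_, ?_⟩
  · exact (BernoulliMatrix.sum_filter_eq_prob t N
      fun A => (BernoulliMatrix.toReal A).det = 0).trans_le (hle N)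
  · exact hlim.congr fun N => (BernoulliMatrix.sum_filter_eq_prob t N
      fun A => (BernoulliMatrix.toReal A).det ≠ 0).symm
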